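/- arXiv:2305.15672 — 3 statements merged into one kernel-verified Lean document; each statement's English description precedes it below -/
import Mathlib

section
/- Let G be a group generated by a finite set, with evaluation map eval from words over the generators and their inverses to G. If there exists an injective monoid homomorphism from the trace monoid T(P_4) into G, then G contains a fixed rational subset in which membership is undecidable: there is a regular language L over the generators and their inverses such that the predicate w ↦ eval(w) ∈ eval(L) on words is not computable. -/
/-- The defining relations of the trace monoid `T(P_4)` of the path with four vertices:
consecutive generators commute. -/
def tracePathRel : FreeMonoid (Fin 4) → FreeMonoid (Fin 4) → Prop := fun p q =>
  ∃ i : Fin 3, p = FreeMonoid.of i.castSucc * FreeMonoid.of i.succ ∧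
    q = FreeMonoid.of i.succ * FreeMonoid.of i.castSucc

/-- The trace monoid `T(P_4)`. -/
abbrev TP4 := PresentedMonoid tracePathRel

/-- Evaluation of a word over the generators and their formal inverses in a group:
a letter `(i, false)` is sent to `gen i` and a letter `(i, true)` to `(gen i)⁻¹`. -/
def evalGrpWord {k : ℕ} {G : Type*} [Group G] (gen : Fin k → G)
    (w : List (Fin k × Bool)) : G :=
  (w.map fun p => if p.2 then (gen p.1)⁻¹ else gen p.1).prod

open scoped Pointwise Computability

namespace Language

variable {α : Type*}

theorem isRegular_zero : (0 : Language α).IsRegular :=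
  .of_finite_range_leftQuotient <| (Set.finite_singleton 0).subset <| by
    rintro _ ⟨x, rfl⟩
    ext y
    exact Iff.rfl

theorem isRegular_one : (1 : Language α).IsRegular := by
  refine .of_finite_range_leftQuotient <| (Set.toFinite {0, 1}).subset ?_
  rintro _ ⟨_ | ⟨a, x⟩, rfl⟩
  · right; rfl
  · left
    ext y
    simp [mem_one, notMem_zero]

theorem isRegular_singleton (a : α) : ({[a]} : Language α).IsRegular := by
  refine .of_finite_range_leftQuotient <| (Set.toFinite {0, 1, {[a]}}).subset ?_
  rintro _ ⟨_ | ⟨b, x⟩, rfl⟩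
  · simp
  · by_cases h : b = a ∧ x = []
    · right; left
      ext y
      change b :: x ++ y = [a] ↔ y = []
      simp [h]
    · left
      ext y
      change b :: x ++ y = [a] ↔ False
      simp only [List.cons_append, List.cons.injEq, List.append_eq_nil_iff]
      tauto

theorem IsRegular.mul {L M : Language α} (hL : L.IsRegular) (hM : M.IsRegular) :
    (L * M).IsRegular := by
  refine .of_finite_range_leftQuotient <|
    (hL.finite_range_leftQuotient.image2 (fun A T => A * M + (sSup T : Language α))
      hM.finite_range_leftQuotient.finite_subsets).subset ?_
  rintro _ ⟨x, rfl⟩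
  refine ⟨_, ⟨x, rfl⟩, {A | ∃ x₁ ∈ L, ∃ x₂, x₁ ++ x₂ = x ∧ A = M.leftQuotient x₂}, ?_, ?_⟩
  · rintro _ ⟨_, _, x₂, _, rfl⟩
    exact ⟨x₂, rfl⟩
  · ext y
    simp only [mem_add, mem_leftQuotient, mem_mul]
    have hs : ∀ T : Set (Language α), y ∈ (sSup T : Language α) ↔ ∃ A ∈ T, y ∈ A :=
      fun T => Set.mem_sUnion
    rw [hs]
    constructor
    · rintro (⟨a, ha, b, hb, rfl⟩ | ⟨_, ⟨x₁, h₁, x₂, rfl, rfl⟩, h⟩)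
      · exact ⟨x ++ a, ha, b, hb, by simp⟩
      · exact ⟨x₁, h₁, x₂ ++ y, h, by simp⟩
    · rintro ⟨a, ha, b, hb, hab⟩
      obtain ⟨c, rfl, rfl⟩ | ⟨c, rfl, rfl⟩ := List.append_eq_append_iff.1 hab
      · exact .inr ⟨_, ⟨a, ha, c, rfl, rfl⟩, hb⟩
      · exact .inl ⟨c, ha, b, hb, rfl⟩

theorem append_mem_kstar {L : Language α} {x y : List α} (hx : x ≠ []) (h : x ++ y ∈ L∗) :
    ∃ x₁ ∈ L∗, ∃ x₂ y₁, ∃ y₂ ∈ L∗, x₁ ++ x₂ = x ∧ y₁ ++ y₂ = y ∧ x₂ ++ y₁ ∈ L := by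
  obtain ⟨S, hS, hL⟩ := mem_kstar.1 h
  clear h
  induction S generalizing x with
  | nil => simp_all
  | cons w S ih =>
    have hw : w ∈ L := hL w (by simp)
    have hS' : ∀ v ∈ S, v ∈ L := fun v hv => hL v (by simp [hv])
    rw [List.flatten_cons] at hS
    obtain ⟨c, rfl, rfl⟩ | ⟨c, rfl, hc⟩ := List.append_eq_append_iff.1 hS
    · exact ⟨[], nil_mem_kstar L, x, c, _, join_mem_kstar hS', rfl, rfl, hw⟩
    · rcases eq_or_ne c [] with rfl | hc'
      · exact ⟨[], nil_mem_kstar L, w, [], y, mem_kstar.2 ⟨S, by simpa using hc.symm, hS'⟩,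
          by simp, rfl, by simpa using hw⟩
      · obtain ⟨x₁, h₁, x₂, y₁, y₂, h₂, rfl, rfl, h⟩ := ih hc' hc.symm hS'
        obtain ⟨T, rfl, hT⟩ := mem_kstar.1 h₁
        exact ⟨_, mem_kstar.2 ⟨w :: T, rfl, by simpa [hw] using hT⟩, x₂, y₁, y₂, h₂,
          by simp, rfl, h⟩

theorem append_mem_kstar_of_mem {L : Language α} {x y : List α} (hx : x ∈ L∗) (hy : y ∈ L∗) :
    x ++ y ∈ L∗ := by
  obtain ⟨S, rfl, hS⟩ := mem_kstar.1 hx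
  obtain ⟨T, rfl, hT⟩ := mem_kstar.1 hy
  exact mem_kstar.2 ⟨S ++ T, by simp, by grind⟩

theorem mem_kstar_of_mem {L : Language α} {x : List α} (hx : x ∈ L) : x ∈ L∗ :=
  mem_kstar.2 ⟨[x], by simp, by simpa⟩

theorem IsRegular.kstar {L : Language α} (hL : L.IsRegular) : (L∗).IsRegular := by
  refine .of_finite_range_leftQuotient <|
    ((hL.finite_range_leftQuotient.finite_subsets.image
      (fun T => (sSup T : Language α) * L∗)).insert L∗).subset ?_
  rintro _ ⟨x, rfl⟩
  rcases eq_or_ne x [] with rfl | hx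
  · left; rfl
  right
  refine ⟨{A | ∃ x₁ ∈ L∗, ∃ x₂, x₁ ++ x₂ = x ∧ A = L.leftQuotient x₂}, ?_, ?_⟩
  · rintro _ ⟨_, _, x₂, _, rfl⟩
    exact ⟨x₂, rfl⟩
  · ext y
    simp only [mem_leftQuotient, mem_mul]
    have hs : ∀ y, ∀ T : Set (Language α), y ∈ (sSup T : Language α) ↔ ∃ A ∈ T, y ∈ A :=
      fun y T => Set.mem_sUnion
    simp only [hs]
    constructor
    · rintro ⟨a, ⟨_, ⟨x₁, h₁, x₂, rfl, rfl⟩, ha⟩, b, hb, rfl⟩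
      have := append_mem_kstar_of_mem h₁ (append_mem_kstar_of_mem (mem_kstar_of_mem ha) hb)
      simpa using this
    · intro h
      obtain ⟨x₁, h₁, x₂, y₁, y₂, h₂, rfl, rfl, hL⟩ := append_mem_kstar hx h
      exact ⟨y₁, ⟨_, ⟨x₁, h₁, x₂, rfl, rfl⟩, hL⟩, y₂, h₂, rfl⟩

theorem IsRegular.preimage_map {β : Type*} {L : Language β} (hL : L.IsRegular) (f : α → β) :
    Language.IsRegular (List.map f ⁻¹' L : Set (List α)) := by
  obtain ⟨σ, _, M, rfl⟩ := hL
  exact ⟨σ, inferInstance, M.comap f, M.accepts_comap f⟩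

/-- A map from words to a monoid that turns concatenation into multiplication sends products of
languages to products of sets. -/
theorem image_mul_of_append {M : Type*} [Monoid M] (e : List α → M)
    (he : ∀ x y, e (x ++ y) = e x * e y) (L K : Language α) :
    e '' (L * K : Language α) = e '' L * e '' K := by
  ext g
  rw [Set.mem_mul]
  constructor
  · rintro ⟨_, ⟨x, hx, y, hy, rfl⟩, rfl⟩
    exact ⟨_, ⟨x, hx, rfl⟩, _, ⟨y, hy, rfl⟩, (he x y).symm⟩
  · rintro ⟨_, ⟨x, hx, rfl⟩, _, ⟨y, hy, rfl⟩, rfl⟩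
    exact ⟨_, ⟨x, hx, y, hy, rfl⟩, he x y⟩

theorem image_kstar_of_append {M : Type*} [Monoid M] (e : List α → M) (h1 : e [] = 1)
    (he : ∀ x y, e (x ++ y) = e x * e y) (L : Language α) :
    e '' (L∗ : Language α) = (Submonoid.closure (e '' L) : Set M) := by
  ext g
  constructor
  · rintro ⟨_, ⟨S, rfl, hS⟩, rfl⟩
    induction S with
    | nil => simp [h1]
    | cons w S ih =>
      rw [List.flatten_cons, he]
      exact mul_mem (Submonoid.subset_closure ⟨w, hS w (by simp), rfl⟩)
        (ih fun v hv => hS v (by simp [hv]))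
  · intro hg
    induction hg using Submonoid.closure_induction with
    | mem g hg =>
      obtain ⟨x, hx, rfl⟩ := hg
      exact ⟨x, mem_kstar_of_mem hx, rfl⟩
    | one => exact ⟨[], nil_mem_kstar L, h1⟩
    | mul g g' _ _ hg hg' =>
      obtain ⟨x, hx, rfl⟩ := hg
      obtain ⟨y, hy, rfl⟩ := hg'
      exact ⟨x ++ y, append_mem_kstar_of_mem hx hy, he x y⟩

end Language

section RationalSubset

variable {k : ℕ} {G : Type*} [Group G] {gen : Fin k → G}

theorem evalGrpWord_nil : evalGrpWord gen [] = 1 := rfl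

theorem evalGrpWord_append (v w : List (Fin k × Bool)) :
    evalGrpWord gen (v ++ w) = evalGrpWord gen v * evalGrpWord gen w := by
  simp [evalGrpWord]

/-- Rational subsets of a group with chosen generators. -/
def IsRationalSubset (gen : Fin k → G) (S : Set G) : Prop :=
  ∃ L : Language (Fin k × Bool), L.IsRegular ∧ evalGrpWord gen '' L = S

namespace IsRationalSubset

variable {S T : Set G}

theorem empty : IsRationalSubset gen ∅ :=
  ⟨0, Language.isRegular_zero, Set.image_empty _⟩

theorem one : IsRationalSubset gen {1} :=
  ⟨1, Language.isRegular_one, Set.image_singleton⟩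

theorem union (hS : IsRationalSubset gen S) (hT : IsRationalSubset gen T) :
    IsRationalSubset gen (S ∪ T) := by
  obtain ⟨L, hL, rfl⟩ := hS
  obtain ⟨M, hM, rfl⟩ := hT
  exact ⟨L + M, hL.add hM, Set.image_union ..⟩

theorem mul (hS : IsRationalSubset gen S) (hT : IsRationalSubset gen T) :
    IsRationalSubset gen (S * T) := by
  obtain ⟨L, hL, rfl⟩ := hS
  obtain ⟨M, hM, rfl⟩ := hT
  exact ⟨L * M, hL.mul hM, Language.image_mul_of_append _ evalGrpWord_append L M⟩

theorem closure (hS : IsRationalSubset gen S) :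
    IsRationalSubset gen (Submonoid.closure S : Set G) := by
  obtain ⟨L, hL, rfl⟩ := hS
  exact ⟨L∗, hL.kstar,
    Language.image_kstar_of_append _ evalGrpWord_nil evalGrpWord_append L⟩

theorem evalGrpWord_reverse_flip (w : List (Fin k × Bool)) :
    evalGrpWord gen (w.map fun p => (p.1, !p.2)).reverse = (evalGrpWord gen w)⁻¹ := by
  induction w with
  | nil => simp [evalGrpWord]
  | cons p w ih =>
    rw [List.map_cons, List.reverse_cons, evalGrpWord_append, ih,
      ← List.singleton_append (l := w), evalGrpWord_append, mul_inv_rev]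
    obtain ⟨i, _ | _⟩ := p <;> simp [evalGrpWord]

theorem inv (hS : IsRationalSubset gen S) : IsRationalSubset gen S⁻¹ := by
  obtain ⟨L, hL, rfl⟩ := hS
  have hflip : ∀ w : List (Fin k × Bool),
      (w.map fun p => (p.1, !p.2)).map (fun p => (p.1, !p.2)) = w := fun w => by
    simp [Function.comp_def]
  refine ⟨_, hL.reverse.preimage_map fun p => (p.1, !p.2), ?_⟩
  ext g
  rw [Set.mem_inv]
  constructor
  · rintro ⟨w, hw, rfl⟩
    exact ⟨_, hw, evalGrpWord_reverse_flip w⟩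
  · rintro ⟨w, hw, hg⟩
    refine ⟨(w.map fun p => (p.1, !p.2)).reverse, ?_, ?_⟩
    · change ((w.map fun p => (p.1, !p.2)).reverse.map fun p => (p.1, !p.2)).reverse ∈ L
      rwa [List.map_reverse, hflip, List.reverse_reverse]
    · rw [evalGrpWord_reverse_flip, hg, inv_inv]

theorem singleton (hgen : Subgroup.closure (Set.range gen) = ⊤) (g : G) :
    IsRationalSubset gen {g} := by
  have hg : g ∈ Subgroup.closure (Set.range gen) := hgen ▸ Subgroup.mem_top g
  induction hg using Subgroup.closure_induction with
  | mem g hg =>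
    obtain ⟨i, rfl⟩ := hg
    exact ⟨_, Language.isRegular_singleton (i, false),
      Set.image_singleton.trans (by simp [evalGrpWord])⟩
  | one => exact one
  | mul g h _ _ hg hh => simpa using hg.mul hh
  | inv g _ hg => simpa using hg.inv

theorem range_pow (hgen : Subgroup.closure (Set.range gen) = ⊤) (g : G) :
    IsRationalSubset gen (Set.range fun t : ℕ => g ^ t) := by
  convert (singleton hgen g).closure
  ext x
  simp [Submonoid.mem_closure_singleton]

end IsRationalSubset

end RationalSubset

section History

/-- The histories of runs on `ℕ` that start at `x` and end at `y`: lists of pairs in which each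
pair starts where the previous one ends. -/
def IsRun : ℕ → List (ℕ × ℕ) → ℕ → Prop
  | x, [], y => x = y
  | x, p :: h, y => p.1 = x ∧ IsRun p.2 h y

theorem isRun_append {x z : ℕ} {h h' : List (ℕ × ℕ)} :
    IsRun x (h ++ h') z ↔ ∃ y, IsRun x h y ∧ IsRun y h' z := by
  induction h generalizing x with
  | nil => simp [IsRun]
  | cons p h ih => simp [IsRun, ih, and_assoc]

theorem isRun_iff {x y : ℕ} {h : List (ℕ × ℕ)} :
    IsRun x h y ↔ x :: h.map Prod.snd = h.map Prod.fst ++ [y] := by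
  induction h generalizing x with
  | nil => simp [IsRun]
  | cons p h ih => simp [IsRun, ih, eq_comm]

/-- The languages of pairs of natural numbers generated from arithmetic progressions by the
regular operations. -/
inductive IsProgram : Language (ℕ × ℕ) → Prop
  | zero : IsProgram 0
  | affine (α β a b : ℕ) : IsProgram {h | ∃ t : ℕ, h = [(a + α * t, b + β * t)]}
  | add {H K} : IsProgram H → IsProgram K → IsProgram (H + K)
  | mul {H K} : IsProgram H → IsProgram K → IsProgram (H * K)
  | kstar {H} : IsProgram H → IsProgram H∗

/-- A relation on `ℕ` is programmable if it is the transition relation of some program. -/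
def Programmable (Q : ℕ → ℕ → Prop) : Prop :=
  ∃ H, IsProgram H ∧ ∀ x y, Q x y ↔ ∃ h ∈ H, IsRun x h y

namespace Programmable

variable {Q R : ℕ → ℕ → Prop}

theorem affine (α β a b : ℕ) :
    Programmable fun x y => ∃ t, x = a + α * t ∧ y = b + β * t := by
  refine ⟨_, .affine α β a b, fun x y => ?_⟩
  constructor
  · rintro ⟨t, rfl, rfl⟩
    exact ⟨_, ⟨t, rfl⟩, rfl, rfl⟩
  · rintro ⟨_, ⟨t, rfl⟩, rfl, rfl⟩
    exact ⟨t, rfl, rfl⟩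

theorem bot : Programmable fun _ _ => False :=
  ⟨0, .zero, fun _ _ => ⟨False.elim, fun ⟨_, h, _⟩ => h⟩⟩

theorem or (hQ : Programmable Q) (hR : Programmable R) :
    Programmable fun x y => Q x y ∨ R x y := by
  obtain ⟨H, hH, hQ⟩ := hQ
  obtain ⟨K, hK, hR⟩ := hR
  refine ⟨_, hH.add hK, fun x y => ?_⟩
  simp only [hQ, hR, Language.mem_add, or_and_right, exists_or]

theorem comp (hQ : Programmable Q) (hR : Programmable R) :
    Programmable fun x z => ∃ y, Q x y ∧ R y z := by
  obtain ⟨H, hH, hQ⟩ := hQ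
  obtain ⟨K, hK, hR⟩ := hR
  refine ⟨_, hH.mul hK, fun x z => ?_⟩
  simp only [hQ, hR, Language.mem_mul]
  constructor
  · rintro ⟨y, ⟨h, hh, r⟩, k, hk, r'⟩
    exact ⟨_, ⟨h, hh, k, hk, rfl⟩, isRun_append.2 ⟨y, r, r'⟩⟩
  · rintro ⟨_, ⟨h, hh, k, hk, rfl⟩, r⟩
    obtain ⟨y, r, r'⟩ := isRun_append.1 r
    exact ⟨y, ⟨h, hh, r⟩, k, hk, r'⟩

theorem star (hQ : Programmable Q) : Programmable (Relation.ReflTransGen Q) := by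
  obtain ⟨H, hH, hQ⟩ := hQ
  refine ⟨_, hH.kstar, fun x y => ?_⟩
  constructor
  · intro h
    induction h with
    | refl => exact ⟨[], Language.nil_mem_kstar H, rfl⟩
    | tail _ hs ih =>
      obtain ⟨h, hh, r⟩ := ih
      obtain ⟨h', hh', r'⟩ := (hQ _ _).1 hs
      exact ⟨h ++ h', Language.append_mem_kstar_of_mem hh (Language.mem_kstar_of_mem hh'),
        isRun_append.2 ⟨_, r, r'⟩⟩
  · rintro ⟨_, ⟨S, rfl, hS⟩, r⟩
    induction S generalizing x with
    | nil => obtain rfl : x = y := r; exact .refl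
    | cons w S ih =>
      rw [List.flatten_cons, isRun_append] at r
      obtain ⟨z, r, r'⟩ := r
      exact .head ((hQ _ _).2 ⟨w, hS w (by simp), r⟩) (ih z (fun v hv => hS v (by simp [hv])) r')

theorem exists_lt {Q : ℕ → ℕ → ℕ → Prop} (n : ℕ) (hQ : ∀ r < n, Programmable (Q r)) :
    Programmable fun x y => ∃ r < n, Q r x y := by
  induction n with
  | zero => simpa using bot
  | succ n ih =>
    convert (ih fun r hr => hQ r (by omega)).or (hQ n (by omega)) using 3
    simp only [Nat.lt_succ_iff_lt_or_eq, or_and_right, exists_or, exists_eq_left]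

theorem not_dvd (p : ℕ) (hp : 0 < p) : Programmable fun x y => y = x ∧ ¬ p ∣ x := by
  convert exists_lt (p - 1) fun r _ => affine p p (r + 1) (r + 1) using 3 with x y
  constructor
  · rintro ⟨rfl, h⟩
    have h0 : 0 < y % p := Nat.pos_of_ne_zero fun h0 => h (Nat.dvd_of_mod_eq_zero h0)
    have h1 := Nat.mod_lt y hp
    have h2 := Nat.mod_add_div y p
    exact ⟨y % p - 1, by omega, y / p, by omega, by omega⟩
  · rintro ⟨r, hr, t, rfl, rfl⟩
    refine ⟨rfl, fun h => ?_⟩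
    have := Nat.le_of_dvd (by omega) ((Nat.dvd_add_left (Dvd.intro t rfl)).1 h)
    omega

end Programmable

end History

section Registers

/-- The prime power encoding of register contents. -/
noncomputable def encodeRegs {m : ℕ} (s : Fin m → ℕ) : ℕ :=
  ∏ i : Fin m, Nat.nth Nat.Prime i ^ s i

theorem prime_nth (i : ℕ) : (Nat.nth Nat.Prime i).Prime :=
  Nat.nth_mem_of_infinite Nat.infinite_setOfPred_prime i

variable {m : ℕ}

theorem encodeRegs_update_succ (s : Fin m → ℕ) (i : Fin m) :
    encodeRegs (Function.update s i (s i + 1)) = Nat.nth Nat.Prime i * encodeRegs s := by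
  classical
  unfold encodeRegs
  rw [← Finset.mul_prod_erase _ _ (Finset.mem_univ i),
    ← Finset.mul_prod_erase _ (fun j : Fin m => Nat.nth Nat.Prime j ^ s j) (Finset.mem_univ i),
    Function.update_self, pow_succ', mul_assoc]
  congr 2
  refine Finset.prod_congr rfl fun j hj => ?_
  rw [Function.update_of_ne (Finset.ne_of_mem_erase hj)]

theorem dvd_encodeRegs_iff {s : Fin m → ℕ} {i : Fin m} :
    Nat.nth Nat.Prime i ∣ encodeRegs s ↔ s i ≠ 0 := by
  constructor
  · intro h hi
    obtain ⟨j, _, hj⟩ := (prime_nth i).prime.exists_mem_finset_dvd h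
    have := (Nat.prime_dvd_prime_iff_eq (prime_nth i) (prime_nth j)).1
      ((prime_nth i).dvd_of_dvd_pow hj)
    have hij : i = j := Fin.ext (Nat.nth_injective Nat.infinite_setOfPred_prime this)
    subst hij
    rw [hi, pow_zero] at hj
    exact (prime_nth i).one_lt.ne' (Nat.dvd_one.1 hj)
  · intro h
    exact (dvd_pow_self _ h).trans
      (Finset.dvd_prod_of_mem (fun j : Fin m => Nat.nth Nat.Prime j ^ s j) (Finset.mem_univ i))

theorem encodeRegs_snoc_zero (s : Fin m → ℕ) :
    encodeRegs (Fin.snoc s 0 : Fin (m + 1) → ℕ) = encodeRegs s := by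
  simp [encodeRegs, Fin.prod_univ_castSucc]

theorem exists_eq_update_succ {s : Fin m → ℕ} {i : Fin m} (h : s i ≠ 0) :
    ∃ s', s = Function.update s' i (s' i + 1) :=
  ⟨Function.update s i (s i - 1), by
    rw [Function.update_self, Function.update_idem, Nat.sub_add_cancel (Nat.pos_of_ne_zero h),
      Function.update_eq_self]⟩

/-- A relation between register contents is realizable if its translation along the prime power
encoding is programmable. -/
def Realizable (B : (Fin m → ℕ) → (Fin m → ℕ) → Prop) : Prop :=
  ∃ Q, Programmable Q ∧ ∀ s x, Q (encodeRegs s) x ↔ ∃ t, x = encodeRegs t ∧ B s t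

/-- A property of register contents is testable if the corresponding partial identity is
realizable. -/
def Testable (φ : (Fin m → ℕ) → Prop) : Prop :=
  Realizable fun s s' => s' = s ∧ φ s

namespace Realizable

variable {B C : (Fin m → ℕ) → (Fin m → ℕ) → Prop}

theorem of_iff (hB : Realizable B) (h : ∀ s s', C s s' ↔ B s s') : Realizable C := by
  rwa [show C = B from funext₂ fun s s' => propext (h s s')]

theorem inc (i : Fin m) : Realizable fun s s' => s' = Function.update s i (s i + 1) := by
  refine ⟨_, .affine 1 (Nat.nth Nat.Prime i) 0 0, fun s x => ?_⟩
  simp [encodeRegs_update_succ]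

theorem dec (i : Fin m) : Realizable fun s s' => s = Function.update s' i (s' i + 1) := by
  refine ⟨_, .affine (Nat.nth Nat.Prime i) 1 0 0, fun s x => ?_⟩
  simp only [zero_add, one_mul]
  constructor
  · rintro ⟨t, hs, rfl⟩
    obtain ⟨s', rfl⟩ := exists_eq_update_succ (dvd_encodeRegs_iff.1 (Dvd.intro x hs.symm))
    rw [encodeRegs_update_succ, Nat.mul_right_inj (prime_nth i).ne_zero] at hs
    exact ⟨s', hs.symm, rfl⟩
  · rintro ⟨s', rfl, rfl⟩
    exact ⟨_, encodeRegs_update_succ s' i, rfl⟩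

theorem comp (hB : Realizable B) (hC : Realizable C) :
    Realizable fun s s'' => ∃ s', B s s' ∧ C s' s'' := by
  obtain ⟨Q, hQ, hB⟩ := hB
  obtain ⟨R, hR, hC⟩ := hC
  refine ⟨_, hQ.comp hR, fun s x => ?_⟩
  constructor
  · rintro ⟨y, h, h'⟩
    obtain ⟨s', rfl, hs⟩ := (hB _ _).1 h
    obtain ⟨s'', rfl, hs'⟩ := (hC _ _).1 h'
    exact ⟨s'', rfl, s', hs, hs'⟩
  · rintro ⟨s'', rfl, s', h, h'⟩
    exact ⟨_, (hB _ _).2 ⟨s', rfl, h⟩, (hC _ _).2 ⟨s'', rfl, h'⟩⟩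

theorem star (hB : Realizable B) : Realizable (Relation.ReflTransGen B) := by
  obtain ⟨Q, hQ, hB⟩ := hB
  refine ⟨_, hQ.star, fun s x => ?_⟩
  constructor
  · intro h
    induction h with
    | refl => exact ⟨s, rfl, .refl⟩
    | tail _ hs ih =>
      obtain ⟨s', rfl, h⟩ := ih
      obtain ⟨s'', rfl, h'⟩ := (hB _ _).1 hs
      exact ⟨s'', rfl, h.tail h'⟩
  · rintro ⟨s', rfl, h⟩
    induction h with
    | refl => exact .refl
    | tail _ hs ih => exact ih.tail ((hB _ _).2 ⟨_, rfl, hs⟩)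

/-- An additional register may be used as long as it is empty before and after. -/
theorem scope {B : (Fin (m + 1) → ℕ) → (Fin (m + 1) → ℕ) → Prop} (hB : Realizable B) :
    Realizable fun s s' : Fin m → ℕ => B (Fin.snoc s 0) (Fin.snoc s' 0) := by
  obtain ⟨Q, hQ, hB⟩ := hB
  refine ⟨_, hQ.comp (.not_dvd (Nat.nth Nat.Prime m) (prime_nth m).pos), fun s x => ?_⟩
  constructor
  · rintro ⟨y, h, rfl, hd⟩
    rw [← encodeRegs_snoc_zero, hB] at h
    obtain ⟨s', rfl, h⟩ := h
    have h0 : s' (Fin.last m) = 0 := by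
      by_contra h0
      exact hd (by simpa using dvd_encodeRegs_iff.2 h0)
    have hs' : (Fin.snoc (Fin.init s') 0 : Fin (m + 1) → ℕ) = s' := by
      rw [← h0, Fin.snoc_init_self]
    exact ⟨Fin.init s', by rw [← encodeRegs_snoc_zero (Fin.init s'), hs'], by simpa only [hs']⟩
  · rintro ⟨s', rfl, h⟩
    refine ⟨_, ?_, rfl, ?_⟩
    · rw [← encodeRegs_snoc_zero s, hB]
      exact ⟨_, (encodeRegs_snoc_zero s').symm, h⟩
    · rw [← encodeRegs_snoc_zero s']
      have := (dvd_encodeRegs_iff (s := (Fin.snoc s' 0 : Fin (m + 1) → ℕ))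
        (i := Fin.last m)).not.2 (by simp)
      simpa using this

end Realizable

theorem update_snoc_last (s : Fin m → ℕ) (x y : ℕ) :
    Function.update (Fin.snoc s x : Fin (m + 1) → ℕ) (Fin.last m) y = Fin.snoc s y :=
  Fin.update_snoc_last ..

theorem update_snoc_castSucc (s : Fin m → ℕ) (x y : ℕ) (i : Fin m) :
    Function.update (Fin.snoc s x : Fin (m + 1) → ℕ) i.castSucc y =
      Fin.snoc (Function.update s i y) x :=
  (Fin.snoc_update ..).symm

namespace Testable

variable {φ ψ : (Fin m → ℕ) → Prop}

theorem of_iff (hφ : Testable φ) (h : ∀ s, ψ s ↔ φ s) : Testable ψ := by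
  rwa [show ψ = φ from funext fun s => propext (h s)]

theorem true : Testable fun _ : Fin m → ℕ => True := by
  refine ⟨_, .affine 1 1 0 0, fun s x => ?_⟩
  simp

theorem false : Testable fun _ : Fin m → ℕ => False :=
  ⟨_, .bot, fun s x => by simp⟩

theorem eq_zero (i : Fin m) : Testable fun s => s i = 0 := by
  refine ⟨_, .not_dvd _ (prime_nth i).pos, fun s x => ?_⟩
  simp [dvd_encodeRegs_iff]

theorem and (hφ : Testable φ) (hψ : Testable ψ) : Testable fun s => φ s ∧ ψ s :=
  (hφ.comp hψ).of_iff fun s s' => by grind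

theorem ne_zero (i : Fin m) : Testable fun s => s i ≠ 0 := by
  refine ((Realizable.dec i).comp (.inc i)).of_iff fun s s' => ?_
  constructor
  · rintro ⟨rfl, h⟩
    obtain ⟨t, rfl⟩ := exists_eq_update_succ h
    exact ⟨t, rfl, rfl⟩
  · rintro ⟨t, rfl, rfl⟩
    simp

theorem all {k : ℕ} {φ : Fin k → (Fin m → ℕ) → Prop} (hφ : ∀ i, Testable (φ i)) :
    Testable fun s => ∀ i, φ i s := by
  induction k with
  | zero => exact true.of_iff (by simp)
  | succ k ih =>
    exact ((hφ 0).and (ih fun i => hφ i.succ)).of_iff fun s => Fin.forall_fin_succ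

end Testable

theorem reflTransGen_update_succ {i : Fin m} {s s' : Fin m → ℕ} :
    Relation.ReflTransGen (fun s s' => s' = Function.update s i (s i + 1)) s s' ↔
      ∃ k, s' = Function.update s i (s i + k) := by
  constructor
  · intro h
    induction h with
    | refl => exact ⟨0, by simp⟩
    | tail _ hs ih =>
      obtain ⟨k, rfl⟩ := ih
      exact ⟨k + 1, by simp [hs, add_assoc]⟩
  · rintro ⟨k, rfl⟩
    induction k with
    | zero => simpa using .refl
    | succ k ih => exact ih.tail (by simp [add_assoc])

theorem Realizable.havoc (i : Fin m) :
    Realizable fun s s' => ∃ x, s' = Function.update s i x := by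
  refine ((Realizable.dec i).star.comp (Realizable.inc i).star).of_iff fun s s' => ?_
  have h : ∀ t, Relation.ReflTransGen (fun s s' => s = Function.update s' i (s' i + 1)) s t ↔
      ∃ k, s = Function.update t i (t i + k) := fun t => by
    rw [← reflTransGen_update_succ]
    exact Relation.reflTransGen_swap
  simp only [h, reflTransGen_update_succ]
  constructor
  · rintro ⟨x, rfl⟩
    exact ⟨Function.update s i 0, ⟨s i, by simp⟩, x, by simp⟩
  · rintro ⟨t, ⟨k, rfl⟩, l, rfl⟩
    exact ⟨t i + l, by simp⟩

namespace Testable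

theorem ex {φ : (Fin (m + 1) → ℕ) → Prop} (hφ : Testable φ) :
    Testable fun s : Fin m → ℕ => ∃ x : ℕ, φ (Fin.snoc s x) := by
  refine (((Realizable.havoc (Fin.last m)).comp hφ).comp
    (Realizable.havoc (Fin.last m))).scope.of_iff fun s s' => ?_
  constructor
  · rintro ⟨rfl, x, hx⟩
    exact ⟨_, ⟨_, ⟨x, rfl⟩, rfl, by simpa [update_snoc_last] using hx⟩, 0,
      by simp [update_snoc_last]⟩
  · rintro ⟨_, ⟨_, ⟨x, rfl⟩, rfl, h⟩, y, hy⟩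
    simp only [update_snoc_last] at h hy
    exact ⟨(Fin.snoc_injective2 hy).1, x, h⟩

theorem exs {k : ℕ} {φ : (Fin (m + k) → ℕ) → Prop} (hφ : Testable φ) :
    Testable fun s : Fin m → ℕ => ∃ z : Fin k → ℕ, φ (Fin.append s z) := by
  induction k with
  | zero =>
    refine hφ.of_iff fun s => ?_
    have h : ∀ z : Fin 0 → ℕ, Fin.append s z = s := fun z => by
      rw [Subsingleton.elim z Fin.elim0, Fin.append_elim0]; rfl
    simp [h]
  | succ k ih =>
    refine (ih hφ.ex).of_iff fun s => ?_
    constructor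
    · rintro ⟨z, hz⟩
      refine ⟨Fin.init z, z (Fin.last k), ?_⟩
      rwa [← Fin.snoc_init_self z, Fin.append_snoc] at hz
    · rintro ⟨z, x, h⟩
      exact ⟨Fin.snoc z x, by rwa [Fin.append_snoc]⟩

end Testable

/-- Moving one unit from each of the registers `i` and `j` to register `l`. -/
def MoveUnits (i j l : Fin m) (k : ℕ) (s s' : Fin m → ℕ) : Prop :=
  s i = s' i + k ∧ s j = s' j + k ∧ s' l = s l + k ∧ ∀ r, r ≠ i → r ≠ j → r ≠ l → s' r = s r

theorem MoveUnits.reflTransGen {i j l : Fin m} (hil : i ≠ l) (hjl : j ≠ l) {s s' : Fin m → ℕ} :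
    Relation.ReflTransGen (MoveUnits i j l 1) s s' ↔ ∃ k, MoveUnits i j l k s s' := by
  constructor
  · intro h
    induction h with
    | refl => exact ⟨0, by simp [MoveUnits]⟩
    | tail _ hs ih =>
      obtain ⟨k, h₁, h₂, h₃, h₄⟩ := ih
      obtain ⟨g₁, g₂, g₃, g₄⟩ := hs
      exact ⟨k + 1, by omega, by omega, by omega, by grind⟩
  · rintro ⟨k, h⟩
    induction k generalizing s' with
    | zero =>
      obtain ⟨h₁, h₂, h₃, h₄⟩ := h
      convert Relation.ReflTransGen.refl
      ext r
      grind
    | succ k ih =>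
      obtain ⟨h₁, h₂, h₃, h₄⟩ := h
      refine (ih (s' := fun r => if r = l then s' r - 1 else
        if r = i ∨ r = j then s' r + 1 else s' r) ?_).tail ?_
      · refine ⟨?_, ?_, ?_, ?_⟩ <;> grind
      · refine ⟨?_, ?_, ?_, ?_⟩ <;> grind

theorem Realizable.moveUnits {i j l : Fin m} (hij : i ≠ j) (hil : i ≠ l) (hjl : j ≠ l) :
    Realizable (MoveUnits i j l 1) := by
  refine (((Realizable.dec i).comp (.dec j)).comp (.inc l)).of_iff fun s s' => ?_
  constructor
  · rintro ⟨h₁, h₂, h₃, h₄⟩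
    refine ⟨Function.update s' l (s l), ⟨Function.update (Function.update s' l (s l)) j (s j),
      ?_, ?_⟩, ?_⟩ <;> ext r <;> simp only [Function.update_apply] <;> grind
  · rintro ⟨_, ⟨_, rfl, rfl⟩, rfl⟩
    refine ⟨?_, ?_, ?_, fun r _ _ _ => ?_⟩ <;> simp only [Function.update_apply] <;> grind

theorem Realizable.moveUnits_symm {i j l : Fin m} (hij : i ≠ j) (hil : i ≠ l) (hjl : j ≠ l) :
    Realizable fun s s' => MoveUnits i j l 1 s' s := by
  refine (((Realizable.dec l).comp (.inc i)).comp (.inc j)).of_iff fun s s' => ?_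
  constructor
  · rintro ⟨h₁, h₂, h₃, h₄⟩
    refine ⟨Function.update (Function.update s l (s' l)) i (s' i),
      ⟨Function.update s l (s' l), ?_, ?_⟩, ?_⟩ <;> ext r <;>
      simp only [Function.update_apply] <;> grind
  · rintro ⟨_, ⟨_, rfl, rfl⟩, rfl⟩
    refine ⟨?_, ?_, ?_, fun r _ _ _ => ?_⟩ <;> simp only [Function.update_apply] <;> grind

namespace Testable

theorem eq (i j : Fin m) : Testable fun s => s i = s j := by
  rcases eq_or_ne i j with rfl | hij
  · exact true.of_iff (by simp)
  have hil : i.castSucc ≠ Fin.last m := i.castSucc_ne_last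
  have hjl : j.castSucc ≠ Fin.last m := j.castSucc_ne_last
  have hij' : i.castSucc ≠ j.castSucc := by simpa using hij
  refine (((Realizable.moveUnits hij' hil hjl).star.comp
    ((eq_zero i.castSucc).and (eq_zero j.castSucc))).comp
    (Realizable.moveUnits_symm hij' hil hjl).star).scope.of_iff fun s s' => ?_
  have h : ∀ t t', Relation.ReflTransGen
      (fun s s' => MoveUnits i.castSucc j.castSucc (Fin.last m) 1 s' s) t t' ↔
      ∃ k, MoveUnits i.castSucc j.castSucc (Fin.last m) k t' t := fun t t' => by
    rw [← MoveUnits.reflTransGen hil hjl]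
    exact Relation.reflTransGen_swap
  simp only [h, MoveUnits.reflTransGen hil hjl]
  constructor
  · rintro ⟨rfl, hs⟩
    have hm : MoveUnits i.castSucc j.castSucc (Fin.last m) (s' i) (Fin.snoc s' 0)
        (Fin.snoc (Function.update (Function.update s' i 0) j 0) (s' i)) := by
      refine ⟨?_, ?_, ?_, fun r => Fin.lastCases ?_ (fun r => ?_) r⟩ <;> simp +contextual [hs, hij]
    exact ⟨_, ⟨_, ⟨_, hm⟩, rfl, by simp [hij], by simp⟩, _, hm⟩
  · rintro ⟨t, ⟨_, ⟨k, h₁, h₂, h₃, h₄⟩, rfl, h₅, h₆⟩, k', g₁, g₂, g₃, g₄⟩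
    simp only [Fin.snoc_castSucc, Fin.snoc_last] at *
    refine ⟨funext fun r => ?_, by omega⟩
    by_cases hri : r = i
    · subst hri; omega
    by_cases hrj : r = j
    · subst hrj; omega
    have e₁ := h₄ r.castSucc (by simpa) (by simpa) r.castSucc_ne_last
    have e₂ := g₄ r.castSucc (by simpa) (by simpa) r.castSucc_ne_last
    simp only [Fin.snoc_castSucc] at e₁ e₂
    omega

theorem eq_succ (o i : Fin m) : Testable fun s => s o = s i + 1 := by
  rcases eq_or_ne o i with rfl | h
  · exact false.of_iff (by simp)
  refine (((Realizable.dec o).comp (eq o i)).comp (.inc o)).of_iff fun s s' => ?_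
  constructor
  · rintro ⟨rfl, hs⟩
    obtain ⟨t, rfl⟩ := exists_eq_update_succ (s := s') (i := o) (by omega)
    exact ⟨t, ⟨t, rfl, rfl, by simpa [h.symm] using hs⟩, rfl⟩
  · rintro ⟨_, ⟨t, rfl, rfl, ht⟩, rfl⟩
    exact ⟨rfl, by simp [h.symm, ht]⟩

theorem forall_lt {φ : (Fin (m + 1) → ℕ) → Prop} (hφ : Testable φ) (o : Fin m) :
    Testable fun s : Fin m → ℕ => ∀ x < s o, φ (Fin.snoc s x) := by
  have body := hφ.comp (.inc (Fin.last m))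
  refine ((body.star.comp (eq o.castSucc (Fin.last m))).comp
    (.havoc (Fin.last m))).scope.of_iff fun s s' => ?_
  have key : ∀ t, Relation.ReflTransGen (fun s s'' => ∃ s', (s' = s ∧ φ s) ∧
      s'' = Function.update s' (Fin.last m) (s' (Fin.last m) + 1)) (Fin.snoc s 0) t ↔
      ∃ k, t = Fin.snoc s k ∧ ∀ x < k, φ (Fin.snoc s x) := fun t => by
    constructor
    · intro h
      induction h with
      | refl => exact ⟨0, rfl, by simp⟩
      | tail _ hs ih =>
        obtain ⟨k, rfl, hk⟩ := ih
        obtain ⟨_, ⟨rfl, hs⟩, rfl⟩ := hs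
        refine ⟨k + 1, by simp [update_snoc_last], fun x hx => ?_⟩
        rcases Nat.lt_succ_iff_lt_or_eq.1 hx with hx | rfl
        exacts [hk x hx, hs]
    · rintro ⟨k, rfl, hk⟩
      induction k with
      | zero => exact .refl
      | succ k ih =>
        exact (ih fun x hx => hk x (by omega)).tail
          ⟨_, ⟨rfl, hk k (by omega)⟩, by simp [update_snoc_last]⟩
  simp only [key]
  constructor
  · rintro ⟨rfl, hs⟩
    exact ⟨_, ⟨_, ⟨_, rfl, hs⟩, rfl, by simp⟩, 0, by simp [update_snoc_last]⟩
  · rintro ⟨_, ⟨_, ⟨k, rfl, hk⟩, rfl, ho⟩, x, hx⟩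
    simp only [Fin.snoc_castSucc, Fin.snoc_last, update_snoc_last] at ho hx
    exact ⟨(Fin.snoc_injective2 hx).1, by rwa [ho]⟩

end Testable

/-- Registers may be overwritten with values described by a testable property. -/
theorem Realizable.assign {φ : (Fin (m + 1) → ℕ) → Prop} (hφ : Testable φ) (j : Fin m) :
    Realizable fun s s' => ∃ x : ℕ, φ (Fin.snoc s x) ∧ s' = Function.update s j x := by
  refine (((((Realizable.havoc (Fin.last m)).comp hφ).comp (.havoc j.castSucc)).comp
    (Testable.eq j.castSucc (Fin.last m))).comp (.havoc (Fin.last m))).scope.of_iff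
    fun s s' => ?_
  constructor
  · rintro ⟨x, hx, rfl⟩
    exact ⟨_, ⟨_, ⟨_, ⟨_, ⟨x, rfl⟩, rfl, by simpa [update_snoc_last] using hx⟩, x, rfl⟩, rfl,
      by simp [update_snoc_last, update_snoc_castSucc, -Fin.snoc_update]⟩, 0,
      by simp [update_snoc_last, update_snoc_castSucc, -Fin.snoc_update]⟩
  · rintro ⟨_, ⟨_, ⟨_, ⟨_, ⟨x, rfl⟩, rfl, hx⟩, y, rfl⟩, rfl, hy⟩, z, hz⟩
    simp only [update_snoc_last, update_snoc_castSucc, Fin.snoc_last,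
      Function.update_self] at hx hy hz
    exact ⟨x, hx, hy ▸ (Fin.snoc_injective2 hz).1⟩

/-- A relation is representable if it is testable on arbitrarily chosen registers. -/
def Representable {n : ℕ} (R : (Fin n → ℕ) → ℕ → Prop) : Prop :=
  ∀ (m : ℕ) (ins : Fin n → Fin m) (o : Fin m), Testable fun s => R (s ∘ ins) (s o)

namespace Representable

variable {n : ℕ}

theorem of_iff {R S : (Fin n → ℕ) → ℕ → Prop} (hR : Representable R)
    (h : ∀ v y, S v y ↔ R v y) : Representable S := by
  rwa [show S = R from funext₂ fun v y => propext (h v y)]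

theorem zero : Representable fun (_ : Fin n → ℕ) y => y = 0 :=
  fun _ _ o => .eq_zero o

theorem succ (i : Fin n) : Representable fun (v : Fin n → ℕ) y => y = v i + 1 :=
  fun _ ins o => .eq_succ o (ins i)

theorem get (i : Fin n) : Representable fun (v : Fin n → ℕ) y => y = v i :=
  fun _ ins o => .eq o (ins i)

theorem comp {k : ℕ} {R : (Fin k → ℕ) → ℕ → Prop} {S : Fin k → (Fin n → ℕ) → ℕ → Prop}
    (hR : Representable R) (hS : ∀ i, Representable (S i)) :
    Representable fun v y => ∃ z : Fin k → ℕ, (∀ i, S i v (z i)) ∧ R z y := fun m ins o => by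
  refine ((Testable.all fun i => hS i (m + k) (Fin.castAdd k ∘ ins) (Fin.natAdd m i)).and
    (hR (m + k) (Fin.natAdd m) (Fin.castAdd k o))).exs.of_iff fun s => ?_
  simp [Function.comp_def]

theorem rfind {f : (Fin (n + 1) → ℕ) → ℕ} (hf : Representable fun v y => y = f v) :
    Representable fun v y => f (Fin.cons y v) = 0 ∧ ∀ x < y, f (Fin.cons x v) ≠ 0 :=
    fun m ins o => by
  refine (((hf (m + 1) (Fin.castSucc ∘ Fin.cons o ins) (Fin.last m)).and
    (.eq_zero (Fin.last m))).ex.and (Testable.forall_lt (((hf (m + 2)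
      (Fin.castSucc ∘ Fin.cons (Fin.last m) (Fin.castSucc ∘ ins)) (Fin.last (m + 1))).and
    (.ne_zero (Fin.last (m + 1)))).ex) o)).of_iff fun s => ?_
  simp [← Function.comp_assoc, Fin.comp_cons]

theorem prec {f : (Fin n → ℕ) → ℕ} {g : (Fin (n + 2) → ℕ) → ℕ}
    (hf : Representable fun v y => y = f v) (hg : Representable fun v y => y = g v) :
    Representable fun (v : Fin (n + 1) → ℕ) y =>
      y = Nat.rec (f (Fin.tail v)) (fun k a => g (Fin.cons k (Fin.cons a (Fin.tail v)))) (v 0) :=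
    fun m ins o => by
  let up : Fin m → Fin (m + 2) := fun i => i.castSucc.castSucc
  let c : Fin (m + 2) := (Fin.last m).castSucc
  let a : Fin (m + 2) := Fin.last (m + 1)
  have hinit := Realizable.assign (hf (m + 3) (Fin.castSucc ∘ up ∘ Fin.tail ins)
    (Fin.last (m + 2))) a
  have hstep := (Realizable.assign (hg (m + 3)
    (Fin.castSucc ∘ Fin.cons c (Fin.cons a (up ∘ Fin.tail ins))) (Fin.last (m + 2))) a).comp
    (.inc c)
  refine (((((hinit.comp hstep.star).comp (Testable.eq c (up (ins 0)))).comp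
    (Testable.eq (up o) a)).comp (.havoc a)).comp (.havoc c)).scope.scope.of_iff fun s s' => ?_
  let st : ℕ → ℕ → Fin (m + 2) → ℕ := fun k x =>
    Fin.snoc (Fin.snoc s k : Fin (m + 1) → ℕ) x
  let F : ℕ → ℕ := fun N => Nat.rec (f (Fin.tail (s ∘ ins)))
    (fun k x => g (Fin.cons k (Fin.cons x (Fin.tail (s ∘ ins))))) N
  have st_up : ∀ k x i, st k x (up i) = s i := fun k x i => by simp [st, up]
  have st_up' : ∀ k x, st k x ∘ up = s := fun k x => funext (st_up k x)
  have st_c : ∀ k x, st k x c = k := fun k x => by simp [st, c]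
  have st_a : ∀ k x, st k x a = x := fun k x => by simp [st, a]
  have up_c : ∀ k x y, Function.update (st k x) c y = st y x := fun k x y => by
    simp only [st, c, update_snoc_castSucc, update_snoc_last]
  have up_a : ∀ k x y, Function.update (st k x) a y = st k y := fun k x y =>
    update_snoc_last ..
  have snoc_comp : ∀ {l p : ℕ} (t : Fin l → ℕ) (x : ℕ) (r : Fin p → Fin l),
      (Fin.snoc t x : Fin (l + 1) → ℕ) ∘ Fin.castSucc ∘ r = t ∘ r := fun t x r => by
    ext; simp
  have tail_comp : s ∘ Fin.tail ins = Fin.tail (s ∘ ins) := rfl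
  simp only [snoc_comp, Fin.snoc_last, Fin.snoc_castSucc, Fin.comp_cons,
    exists_eq_left] at hinit hstep ⊢
  rw [show (Fin.snoc (Fin.snoc s 0 : Fin (m + 1) → ℕ) 0 : Fin (m + 2) → ℕ) = st 0 0 from rfl]
  simp only [← Function.comp_assoc, st_up', up_a, tail_comp]
  have key : ∀ t, Relation.ReflTransGen (fun t t' : Fin (m + 2) → ℕ => t' =
      Function.update (Function.update t a
        (g (Fin.cons (t c) (Fin.cons (t a) ((t ∘ up) ∘ Fin.tail ins))))) c
      (Function.update t a
        (g (Fin.cons (t c) (Fin.cons (t a) ((t ∘ up) ∘ Fin.tail ins)))) c + 1)) (st 0 (F 0)) t ↔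
      ∃ k, t = st k (F k) := fun t => by
    constructor
    · intro h
      induction h with
      | refl => exact ⟨0, rfl⟩
      | tail _ hs ih =>
        obtain ⟨k, rfl⟩ := ih
        obtain rfl := hs
        exact ⟨k + 1, by simp only [up_a, up_c, st_c, st_a, st_up']; rfl⟩
    · rintro ⟨k, rfl⟩
      induction k with
      | zero => exact .refl
      | succ k ih =>
        exact ih.tail (by simp only [up_a, up_c, st_c, st_a, st_up']; rfl)
  constructor
  · rintro ⟨rfl, h⟩
    exact ⟨_, ⟨_, ⟨_, ⟨_, (key _).2 ⟨s' (ins 0), rfl⟩, rfl, (st_c ..).trans (st_up ..).symm⟩,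
      rfl, (st_up ..).trans (h.trans (st_a ..).symm)⟩, 0, (up_a ..).symm⟩, 0, (up_c ..).symm⟩
  · rintro ⟨_, ⟨_, ⟨_, ⟨_, ht, rfl, hc⟩, rfl, ho⟩, x, rfl⟩, y, hy⟩
    obtain ⟨k, rfl⟩ := (key _).1 ht
    rw [st_c, st_up] at hc
    rw [st_a, st_up] at ho
    rw [up_a, up_c] at hy
    subst hc
    exact ⟨(Fin.snoc_injective2 (Fin.snoc_injective2 hy).1).1, ho⟩

theorem ofFn_cons (x : ℕ) (v : Fin n → ℕ) :
    List.Vector.ofFn (Fin.cons x v : Fin (n + 1) → ℕ) = x ::ᵥ List.Vector.ofFn v := by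
  simp [List.Vector.ofFn]

theorem of_primrec' {f : List.Vector ℕ n → ℕ} (hf : Nat.Primrec' f) :
    Representable fun v y => y = f (List.Vector.ofFn v) := by
  induction hf with
  | zero => exact zero
  | succ => exact (succ 0).of_iff fun v y => by simp
  | get i => exact (get i).of_iff fun v y => by simp
  | @comp m n f g _ _ hf hg =>
    refine (hf.comp hg).of_iff fun v y => ?_
    constructor
    · rintro rfl
      exact ⟨_, fun i => rfl, rfl⟩
    · rintro ⟨z, hz, rfl⟩
      rw [funext hz]
  | prec _ _ hf hg =>
    refine (hf.prec hg).of_iff fun v y => ?_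
    simp only [ofFn_cons, List.Vector.head_ofFn, List.Vector.tail_ofFn]
    rfl

theorem mem_mOfFn {g : Fin n → Part ℕ} {z : List.Vector ℕ n} :
    z ∈ List.Vector.mOfFn g ↔ ∀ i, z.get i ∈ g i := by
  induction n with
  | zero =>
    simpa [List.Vector.mOfFn] using List.Vector.eq_nil z
  | succ n ih =>
    simp only [List.Vector.mOfFn, Part.pure_eq_some, Part.bind_eq_bind, Part.mem_bind_iff,
      Part.mem_some_iff, ih, Fin.forall_fin_succ]
    constructor
    · rintro ⟨x, hx, w, hw, rfl⟩
      exact ⟨by simpa using hx, fun i => by simpa using hw i⟩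
    · rintro ⟨h0, hs⟩
      exact ⟨_, h0, z.tail, fun i => by simpa using hs i, by simp⟩

theorem of_partrec' {f : List.Vector ℕ n →. ℕ} (hf : Nat.Partrec' f) :
    Representable fun v y => y ∈ f (List.Vector.ofFn v) := by
  induction hf with
  | prim hf => exact (of_primrec' hf).of_iff fun v y => by simp
  | comp g _ _ hf hg =>
    refine (hf.comp hg).of_iff fun v y => ?_
    refine Part.mem_bind_iff.trans ?_
    simp only [mem_mOfFn]
    constructor
    · rintro ⟨z, hz, hy⟩
      exact ⟨z.get, hz, by rwa [List.Vector.ofFn_get]⟩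
    · rintro ⟨z, hz, hy⟩
      exact ⟨_, fun i => by simpa using hz i, hy⟩
  | @rfind n f _ hf =>
    have hf' : Representable fun v y => y = f (List.Vector.ofFn v) :=
      hf.of_iff fun v y => by simp
    refine hf'.rfind.of_iff fun v y => ?_
    refine Nat.mem_rfind.trans ?_
    simp [ofFn_cons]

end Representable

theorem encodeRegs_one (n : ℕ) : encodeRegs (fun _ : Fin 1 => n) = 2 ^ n := by
  simp [encodeRegs, Nat.nth_prime_zero_eq_two]

end Registers

/-- The domain of every partial recursive function is described by the runs of a program. -/
theorem exists_isProgram_of_partrec {f : ℕ →. ℕ} (hf : Partrec f) :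
    ∃ H, IsProgram H ∧ ∀ n, (f n).Dom ↔ ∃ h ∈ H, ∃ y, IsRun (2 ^ n) h y := by
  have h := (Representable.of_partrec' (Nat.Partrec'.part_iff₁.2 hf) 2 (fun _ => 0) 1).ex
  obtain ⟨Q, ⟨H, hH, hQH⟩, hQ⟩ := h
  refine ⟨H, hH, fun n => ?_⟩
  have h1 := fun x => (hQH (2 ^ n) x).symm.trans (encodeRegs_one n ▸ hQ (fun _ : Fin 1 => n) x)
  rw [Part.dom_iff_mem]
  constructor
  · rintro ⟨y, hy⟩
    obtain ⟨h, hh, r⟩ := (h1 _).2 ⟨_, rfl, rfl, y, by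
      simpa [Fin.snoc] using hy⟩
    exact ⟨h, hh, _, r⟩
  · rintro ⟨h, hh, x, r⟩
    obtain ⟨_, rfl, rfl, y, hy⟩ := (h1 _).1 ⟨h, hh, r⟩
    exact ⟨y, by simpa [Fin.snoc] using hy⟩

section Traces

/-- The trace of a history. -/
def histProd {M : Type*} [Monoid M] (u : Fin 4 → M) (h : List (ℕ × ℕ)) : M :=
  (h.map fun p => u 0 * u 3 * u 2 ^ p.1 * u 1 ^ p.2).prod

/-- The trace of a list of matching pairs of numbers. -/
def linkProd {M : Type*} [Monoid M] (u : Fin 4 → M) (ts : List ℕ) : M :=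
  (ts.map fun t => u 1 ^ t * u 0 * u 2 ^ t * u 3).prod

variable {M N : Type*} [Monoid M] [Monoid N] (u : Fin 4 → M)

theorem histProd_nil : histProd u [] = 1 := rfl

theorem histProd_append (h h' : List (ℕ × ℕ)) :
    histProd u (h ++ h') = histProd u h * histProd u h' := by
  simp [histProd]

theorem histProd_cons (p : ℕ × ℕ) (h : List (ℕ × ℕ)) :
    histProd u (p :: h) = u 0 * u 3 * u 2 ^ p.1 * u 1 ^ p.2 * histProd u h := by
  simp [histProd]

theorem linkProd_cons (t : ℕ) (ts : List ℕ) :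
    linkProd u (t :: ts) = u 1 ^ t * u 0 * u 2 ^ t * u 3 * linkProd u ts := by
  simp [linkProd]

theorem map_histProd (φ : M →* N) (h : List (ℕ × ℕ)) :
    φ (histProd u h) = histProd (φ ∘ u) h := by
  simp [histProd, map_list_prod, Function.comp_def]

theorem map_linkProd (φ : M →* N) (ts : List ℕ) :
    φ (linkProd u ts) = linkProd (φ ∘ u) ts := by
  simp [linkProd, map_list_prod, Function.comp_def]

variable {u}

theorem IsRun.pow_mul_histProd (hu : Commute (u 2) (u 3)) {x y : ℕ} {h : List (ℕ × ℕ)}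
    (hr : IsRun x h y) :
    u 1 ^ x * histProd u h = linkProd u (h.map Prod.fst) * u 1 ^ y := by
  induction h generalizing x with
  | nil =>
    obtain rfl : x = y := hr
    simp [histProd, linkProd]
  | cons p h ih =>
    obtain ⟨rfl, hr⟩ := hr
    rw [List.map_cons, linkProd_cons, mul_assoc _ (linkProd u _), ← ih hr, histProd_cons]
    simp only [mul_assoc, (hu.pow_left p.1).left_comm]

theorem tracePathRel_lift {u : Fin 4 → M} (h : ∀ i : Fin 3, Commute (u i.castSucc) (u i.succ))
    (a b : FreeMonoid (Fin 4)) (hab : tracePathRel a b) :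
    FreeMonoid.lift u a = FreeMonoid.lift u b := by
  obtain ⟨i, rfl, rfl⟩ := hab
  simpa using (h i).eq

/-- Incrementing the current counter. -/
def incCounter : Function.End (ℕ × List ℕ) := fun s => (s.1 + 1, s.2)

/-- Storing the current counter and starting a new one. -/
def pushCounter : Function.End (ℕ × List ℕ) := fun s => (0, s.1 :: s.2)

theorem incCounter_pow (n : ℕ) (s : ℕ × List ℕ) : (incCounter ^ n) s = (s.1 + n, s.2) := by
  induction n with
  | zero => rfl
  | succ n ih =>
    rw [pow_succ']
    exact congrArg incCounter ih

theorem endMul_apply {α : Type*} (f g : Function.End α) (x : α) : (f * g) x = f (g x) := rfl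

theorem prod_push_inc (l : List ℕ) :
    (l.map fun t => pushCounter * incCounter ^ t).prod (0, []) = (0, l) := by
  induction l with
  | nil => rfl
  | cons t l ih =>
    rw [List.map_cons, List.prod_cons]
    rw [endMul_apply, endMul_apply, ih, incCounter_pow]
    simp [pushCounter]

theorem prod_inc_push (l : List ℕ) (y : ℕ) :
    ((l.map fun t => incCounter ^ t * pushCounter).prod (y, [])).1 ::
      ((l.map fun t => incCounter ^ t * pushCounter).prod (y, [])).2 = l ++ [y] := by
  induction l with
  | nil => rfl
  | cons t l ih =>
    rw [List.map_cons, List.prod_cons]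
    rw [endMul_apply, endMul_apply, incCounter_pow]
    simp [pushCounter, ih]

/-- In the trace monoid, the trace equation satisfied by runs characterizes them. -/
theorem TP4.isRun_of_eq {u : Fin 4 → TP4} (hu : ∀ i, u i = PresentedMonoid.of tracePathRel i)
    {x y : ℕ} {h : List (ℕ × ℕ)} {ts : List ℕ}
    (e : u 1 ^ x * histProd u h = linkProd u ts * u 1 ^ y) : IsRun x h y := by
  let v : Fin 4 → Function.End (ℕ × List ℕ) := ![pushCounter, 1, incCounter, 1]
  let w : Fin 4 → Function.End (ℕ × List ℕ) := ![1, incCounter, 1, pushCounter]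
  have hv : ∀ i : Fin 3, Commute (v i.castSucc) (v i.succ) := by
    intro i; fin_cases i
    exacts [.one_right _, .one_left _, .one_right _]
  have hw : ∀ i : Fin 3, Commute (w i.castSucc) (w i.succ) := by
    intro i; fin_cases i
    exacts [.one_left _, .one_right _, .one_left _]
  have ev := congrArg (PresentedMonoid.lift v (tracePathRel_lift hv)) e
  have ew := congrArg (PresentedMonoid.lift w (tracePathRel_lift hw)) e
  have huv : ∀ i, PresentedMonoid.lift v (tracePathRel_lift hv) (u i) = v i := fun i => by
    rw [hu]; rfl
  have huw : ∀ i, PresentedMonoid.lift w (tracePathRel_lift hw) (u i) = w i := fun i => by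
    rw [hu]; rfl
  simp only [map_mul, map_pow, map_histProd, map_linkProd, huv, huw] at ev ew
  rw [show _ ∘ u = v from funext huv] at ev
  rw [show _ ∘ u = w from funext huw] at ew
  have h1 : histProd v h (0, []) = (0, h.map Prod.fst) := by
    rw [← prod_push_inc (h.map _)]
    simp [histProd, v, Function.comp_def]
  have h2 : linkProd v ts (0, []) = (0, ts) := by
    rw [← prod_push_inc ts]
    simp [linkProd, v]
  have h3 : histProd w h (0, []) = (0, h.map Prod.snd) := by
    rw [← prod_push_inc (h.map _)]
    simp [histProd, w, Function.comp_def]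
  have h4 : (linkProd w ts (y, [])).1 :: (linkProd w ts (y, [])).2 = ts ++ [y] := by
    rw [← prod_inc_push ts]
    simp [linkProd, w]
  have e1 : h.map Prod.fst = ts := by
    have := congrFun ev (0, [])
    simp only [show v 1 = 1 from rfl, one_pow, one_mul, mul_one, h1, h2] at this
    exact (Prod.mk.inj this).2
  have e2 : (x, h.map Prod.snd) = linkProd w ts (y, []) := by
    have := congrFun ew (0, [])
    change (incCounter ^ x) (histProd w h (0, [])) =
      linkProd w ts ((incCounter ^ y) (0, [])) at this
    rw [h3, incCounter_pow, incCounter_pow] at this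
    simpa using this
  rw [isRun_iff, e1, ← h4, ← e2]

variable {k : ℕ} {G : Type*} [Group G] {gen : Fin k → G}

theorem TP4.commute_of (i : Fin 3) :
    Commute (PresentedMonoid.of tracePathRel i.castSucc) (PresentedMonoid.of tracePathRel i.succ) :=
  PresentedMonoid.mk_eq_mk_of_rel ⟨i, rfl, rfl⟩

theorem isRationalSubset_histProd_image (hgen : Subgroup.closure (Set.range gen) = ⊤)
    {u : Fin 4 → G} (hu : Commute (u 1) (u 2)) {H : Language (ℕ × ℕ)} (hH : IsProgram H) :
    IsRationalSubset gen (histProd u '' H) := by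
  induction hH with
  | zero =>
    rw [show histProd u '' (0 : Language (ℕ × ℕ)) = ∅ from Set.image_empty _]
    exact .empty
  | affine α β a b =>
    convert (IsRationalSubset.singleton hgen (u 0 * u 3 * u 2 ^ a * u 1 ^ b)).mul
      (.range_pow hgen (u 2 ^ α * u 1 ^ β)) using 1
    rw [Set.singleton_mul, ← Set.range_comp]
    have e : ∀ t, histProd u [(a + α * t, b + β * t)] =
        u 0 * u 3 * u 2 ^ a * u 1 ^ b * (u 2 ^ α * u 1 ^ β) ^ t := fun t => by
      rw [(hu.symm.pow_pow α β).mul_pow, ← pow_mul, ← pow_mul]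
      simp only [histProd_cons, histProd_nil, pow_add, mul_one, mul_assoc,
        (hu.pow_pow b (α * t)).left_comm]
    ext g
    constructor
    · rintro ⟨_, ⟨t, rfl⟩, rfl⟩
      exact ⟨t, (e t).symm⟩
    · rintro ⟨t, rfl⟩
      exact ⟨_, ⟨t, rfl⟩, e t⟩
  | @add H K _ _ hH hK =>
    rw [show histProd u '' (H + K : Language (ℕ × ℕ)) = _ from Set.image_union ..]
    exact hH.union hK
  | mul _ _ hH hK =>
    rw [Language.image_mul_of_append _ (histProd_append u)]
    exact hH.mul hK
  | kstar _ hH =>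
    rw [Language.image_kstar_of_append _ (histProd_nil u) (histProd_append u)]
    exact hH.closure

theorem isRationalSubset_range_linkProd (hgen : Subgroup.closure (Set.range gen) = ⊤)
    {u : Fin 4 → G} (h01 : Commute (u 0) (u 1)) (h12 : Commute (u 1) (u 2)) :
    IsRationalSubset gen (Set.range (linkProd u)) := by
  have e : ∀ t, u 1 ^ t * u 0 * u 2 ^ t * u 3 = u 0 * (u 1 * u 2) ^ t * u 3 := fun t => by
    rw [h12.mul_pow]
    simp only [mul_assoc, (h01.pow_right t).left_comm]
  convert (((IsRationalSubset.singleton hgen (u 0)).mul (.range_pow hgen (u 1 * u 2))).mul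
    (.singleton hgen (u 3))).closure
  let K : Language ℕ := Set.range fun t => [t]
  have hK : (K∗ : Language ℕ) = (Set.univ : Set (List ℕ)) :=
    Set.eq_univ_of_forall fun ts => Language.mem_kstar.2
      ⟨ts.map fun t => [t], by simp [← List.flatMap_def], fun _ ht =>
        let ⟨t, _, ht⟩ := List.mem_map.1 ht; ⟨t, ht⟩⟩
  rw [← Set.image_univ, ← hK, Language.image_kstar_of_append _ rfl (by simp [linkProd])]
  congr 2
  rw [← Set.range_comp, Set.singleton_mul, Set.mul_singleton, ← Set.range_comp, ← Set.range_comp]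
  congr 1
  ext t
  simp [linkProd, e]

/-- A group containing the trace monoid of the path with four vertices has a fixed rational subset
encoding the halting problem of every partial recursive function. -/
theorem exists_isRationalSubset_of_partrec (hgen : Subgroup.closure (Set.range gen) = ⊤)
    (φ : TP4 →* G) (hφ : Function.Injective φ) {f : ℕ →. ℕ} (hf : Partrec f) :
    ∃ S, IsRationalSubset gen S ∧ ∃ b : G, ∀ n, (f n).Dom ↔ b ^ 2 ^ n ∈ S := by
  obtain ⟨H, hH, hfH⟩ := exists_isProgram_of_partrec hf
  let u := PresentedMonoid.of tracePathRel
  let v := φ ∘ u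
  have hv : ∀ i : Fin 3, Commute (v i.castSucc) (v i.succ) := fun i => (TP4.commute_of i).map φ
  refine ⟨_, ((isRationalSubset_range_linkProd hgen (hv 0) (hv 1)).mul (.range_pow hgen (v 1))).mul
    (isRationalSubset_histProd_image hgen (hv 1) hH).inv, v 1, fun n => ?_⟩
  rw [hfH]
  constructor
  · rintro ⟨h, hh, y, hr⟩
    exact ⟨_, ⟨_, ⟨_, rfl⟩, _, ⟨y, rfl⟩, rfl⟩, _, Set.inv_mem_inv.2 ⟨h, hh, rfl⟩,
      (eq_mul_inv_of_mul_eq (hr.pow_mul_histProd (hv 2))).symm⟩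
  · rintro ⟨_, ⟨_, ⟨ts, rfl⟩, _, ⟨y, rfl⟩, rfl⟩, g, ⟨h, hh, hg⟩, e⟩
    refine ⟨h, hh, y, TP4.isRun_of_eq (u := u) (ts := ts) (fun _ => rfl) (hφ ?_)⟩
    simp only [map_mul, map_pow, map_histProd, map_linkProd]
    have := eq_mul_inv_of_mul_eq e
    rw [← hg] at this
    exact this.symm

end Traces

theorem ComputablePred.comp {α β : Type*} [Primcodable α] [Primcodable β] {p : β → Prop}
    (hp : ComputablePred p) {f : α → β} (hf : Computable f) : ComputablePred fun a => p (f a) := by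
  obtain ⟨q, hq, rfl⟩ := ComputablePred.computable_iff.1 hp
  exact ComputablePred.computable_iff.2 ⟨_, hq.comp hf, rfl⟩

theorem exists_computable_evalGrpWord {k : ℕ} {G : Type*} [Group G] {gen : Fin k → G}
    (hgen : Subgroup.closure (Set.range gen) = ⊤) (b : G) :
    ∃ W : ℕ → List (Fin k × Bool), Computable W ∧ ∀ n, evalGrpWord gen (W n) = b ^ 2 ^ n := by
  obtain ⟨L, -, hL⟩ := IsRationalSubset.singleton hgen b
  obtain ⟨w, -, hw⟩ : b ∈ evalGrpWord gen '' L := hL ▸ rfl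
  refine ⟨fun n => Nat.rec w (fun _ v => v ++ v) n, Primrec.to_comp ?_, fun n => ?_⟩
  · exact Primrec.nat_rec₁ w (Primrec.list_append.comp₂ .right .right)
  · induction n with
    | zero => simpa using hw
    | succ n ih => simp only [evalGrpWord_append, ih, pow_succ, mul_two, pow_add]

/-- If a finitely generated group `G` embeds the trace monoid `T(P_4)`, then `G` contains
a fixed rational subset in which membership is undecidable: there is a regular language
`L` over the generators and their inverses such that membership of the represented
element in the image of `L` in `G` is not computable. -/
theorem group_embedding_TP4_undecidable_rational_subset_membership
    (k : ℕ) (G : Type) [Group G] (gen : Fin k → G)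
    (hgen : Subgroup.closure (Set.range gen) = ⊤)
    (hembed : ∃ φ : TP4 →* G, Function.Injective φ) :
    ∃ L : Language (Fin k × Bool), L.IsRegular ∧
      ¬ ComputablePred fun w : List (Fin k × Bool) =>
        evalGrpWord gen w ∈ evalGrpWord gen '' L := by
  obtain ⟨φ, hφ⟩ := hembed
  have hf : Partrec fun n => (Denumerable.ofNat Nat.Partrec.Code n).eval 0 :=
    Nat.Partrec.Code.eval_part.comp (Computable.ofNat _) (Computable.const 0)
  obtain ⟨_, ⟨L, hL, rfl⟩, b, hb⟩ := exists_isRationalSubset_of_partrec hgen φ hφ hf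
  obtain ⟨W, hW, hWb⟩ := exists_computable_evalGrpWord hgen b
  refine ⟨L, hL, fun h => ComputablePred.halting_problem 0 ?_⟩
  refine (h.comp (hW.comp Computable.encode)).of_eq fun c => ?_
  rw [hWb, ← hb, Denumerable.ofNat_encode]
end

section
/- Let m, n ≥ 2 be integers and let R_{m,n} = Mon⟨a, b | (b a^n)^m (a^n b)^m a = a⟩. Then the submonoid of R_{m,n} generated by the four elements represented by the words a(ba^n)^{m−1}ba^{n−1}, a^{2n}, (ba^n)^m, and ba^n a^{2n}(ba^n)^{m−1} is isomorphic to the trace monoid T(P_4), via an isomorphism sending these four elements (in the listed order) to the generators u₁, u₂, u₃, u₄ of T(P_4). -/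
/-- The `i`-fold concatenation of a word with itself. -/
def listPow {σ : Type*} (w : List σ) (i : ℕ) : List σ :=
  (List.replicate i w).flatten

/-- The one-relation monoid `Mon⟨A | u = v⟩` over the alphabet `Fin k`. -/
abbrev OneRelMonoid {k : ℕ} (u v : List (Fin k)) :=
  PresentedMonoid (fun x y : FreeMonoid (Fin k) =>
    x = FreeMonoid.ofList u ∧ y = FreeMonoid.ofList v)

/-- Evaluation of a word in the one-relation monoid. -/
def OneRelMonoid.eval {k : ℕ} (u v : List (Fin k)) (w : List (Fin k)) :
    OneRelMonoid u v :=
  PresentedMonoid.mk _ (FreeMonoid.ofList w)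

/-- The letter `a`. -/
def aw : List (Fin 2) := [0]

/-- The letter `b`. -/
def bw : List (Fin 2) := [1]

/-- The word `(b a^n)^m (a^n b)^m a`, the left-hand side of the defining relation of
`R_{m,n} = Mon⟨a, b | (b a^n)^m (a^n b)^m a = a⟩`. -/
def rmnLhs (m n : ℕ) : List (Fin 2) :=
  listPow (bw ++ listPow aw n) m ++ listPow (listPow aw n ++ bw) m ++ aw

/-- The one-relation monoid `R_{m,n} = Mon⟨a, b | (b a^n)^m (a^n b)^m a = a⟩`. -/
abbrev Rmn (m n : ℕ) := OneRelMonoid (rmnLhs m n) aw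

/-- Evaluation of a word in `R_{m,n}`. -/
def Rmn.eval (m n : ℕ) (w : List (Fin 2)) : Rmn m n :=
  OneRelMonoid.eval (rmnLhs m n) aw w

/-- Membership of the vertices of `P₄` in the three pairs of non-adjacent vertices
`{0, 2}`, `{0, 3}` and `{1, 3}`. -/
def inNonadjacentPair : Fin 3 → Fin 4 → Bool :=
  ![![true, false, true, false], ![true, false, false, true], ![false, true, false, true]]

lemma exists_inNonadjacentPair : ∀ i, ∃ k, inNonadjacentPair k i := by
  decide

namespace TP4

/-- Evaluation of a word in the trace monoid `T(P_4)`. -/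
def eval (w : List (Fin 4)) : TP4 :=
  PresentedMonoid.mk tracePathRel (FreeMonoid.ofList w)

lemma eval_cons (i : Fin 4) (w : List (Fin 4)) :
    eval (i :: w) = PresentedMonoid.of tracePathRel i * eval w := by
  rw [eval, FreeMonoid.ofList_cons, map_mul]
  rfl

lemma of_mul_of_comm {i j : Fin 4} (hij : j ≠ i)
    (h : ∀ k, inNonadjacentPair k i → ¬ inNonadjacentPair k j) :
    PresentedMonoid.of tracePathRel j * PresentedMonoid.of tracePathRel i =
      PresentedMonoid.of tracePathRel i * PresentedMonoid.of tracePathRel j := by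
  have key : ∃ e : Fin 3, (i = e.castSucc ∧ j = e.succ) ∨ (j = e.castSucc ∧ i = e.succ) := by
    revert i j
    decide
  have comm (e : Fin 3) :
      PresentedMonoid.of tracePathRel e.castSucc * PresentedMonoid.of tracePathRel e.succ =
        PresentedMonoid.of tracePathRel e.succ * PresentedMonoid.of tracePathRel e.castSucc := by
    have := PresentedMonoid.mk_eq_mk_of_rel (rels := tracePathRel) ⟨e, rfl, rfl⟩
    rwa [map_mul, map_mul] at this
  obtain ⟨e, ⟨rfl, rfl⟩ | ⟨rfl, rfl⟩⟩ := key
  · exact (comm e).symm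
  · exact comm e

lemma exists_eval_eq_cons (i : Fin 4) (w : List (Fin 4))
    (h : ∀ k, inNonadjacentPair k i → ∃ l, w.filter (inNonadjacentPair k) = i :: l) :
    ∃ v, eval w = eval (i :: v) ∧
      ∀ k, w.filter (inNonadjacentPair k) = (i :: v).filter (inNonadjacentPair k) := by
  induction w with
  | nil =>
    obtain ⟨k, hk⟩ := exists_inNonadjacentPair i
    obtain ⟨l, hl⟩ := h k hk
    simp at hl
  | cons j w ih =>
    by_cases hij : j = i
    · exact ⟨w, by rw [hij], fun k => by rw [hij]⟩
    have hdisj : ∀ k, inNonadjacentPair k i → ¬ inNonadjacentPair k j := by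
      intro k hi hj
      obtain ⟨l, hl⟩ := h k hi
      rw [List.filter_cons_of_pos hj] at hl
      exact hij (List.cons.inj hl).1
    obtain ⟨v, hv, hf⟩ := ih fun k hk => by
      obtain ⟨l, hl⟩ := h k hk
      rw [List.filter_cons_of_neg (hdisj k hk)] at hl
      exact ⟨l, hl⟩
    refine ⟨j :: v, ?_, fun k => ?_⟩
    · rw [eval_cons, hv, eval_cons, eval_cons, eval_cons, ← mul_assoc, ← mul_assoc,
        of_mul_of_comm hij hdisj]
    · have := hdisj k
      have := hf k
      grind

/-- The projection lemma: a trace is determined by its projections to the pairs of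
non-adjacent vertices. -/
lemma eval_eq_of_filter_eq (w w' : List (Fin 4))
    (h : ∀ k, w.filter (inNonadjacentPair k) = w'.filter (inNonadjacentPair k)) :
    eval w = eval w' := by
  induction w generalizing w' with
  | nil =>
    cases w' with
    | nil => rfl
    | cons i w' =>
      obtain ⟨k, hk⟩ := exists_inNonadjacentPair i
      have := h k
      simp [hk] at this
  | cons i w ih =>
    obtain ⟨v, hv, hf⟩ := exists_eval_eq_cons i w' fun k hk =>
      ⟨_, (h k).symm.trans (List.filter_cons_of_pos hk)⟩
    rw [hv, eval_cons, eval_cons, ih v fun k => ?_]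
    have := (h k).trans (hf k)
    grind

/-- The images of the generators of `T(P_4)` in a product of three free groups, one for each
pair of non-adjacent vertices. -/
def freeGen (i : Fin 4) : Fin 3 → FreeGroup (Fin 4) :=
  fun k => if inNonadjacentPair k i then FreeGroup.of i else 1

lemma freeGen_comm (e : Fin 3) : Commute (freeGen e.castSucc) (freeGen e.succ) := by
  funext k
  have : ¬ (inNonadjacentPair k e.castSucc ∧ inNonadjacentPair k e.succ) := by
    revert e k
    decide
  simp only [freeGen, Pi.mul_apply]
  grind

lemma prod_map_freeGen_apply (w : List (Fin 4)) (k : Fin 3) :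
    (w.map freeGen).prod k =
      FreeGroup.mk ((w.filter (inNonadjacentPair k)).map fun i => (i, true)) := by
  induction w with
  | nil => rfl
  | cons i w ih =>
    rw [List.map_cons, List.prod_cons, Pi.mul_apply, ih, List.filter_cons]
    by_cases hi : inNonadjacentPair k i
    · simp [freeGen, hi, FreeGroup.of, FreeGroup.mul_mk]
    · simp [freeGen, hi]

lemma _root_.FreeGroup.mk_map_true_injective {α : Type*} :
    Function.Injective fun l : List α => FreeGroup.mk (l.map fun i => (i, true)) := by
  classical
  intro l l' h
  have hred (l : List α) : FreeGroup.IsReduced (l.map fun i => (i, true)) := by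
    rw [FreeGroup.IsReduced, List.isChain_map]
    induction l with
    | nil => simp
    | cons a l ih => cases l <;> simp_all
  have := FreeGroup.reduce.sound h
  rw [(hred l).reduce_eq, (hred l').reduce_eq] at this
  exact List.map_injective_iff.2 (fun a b hab => (Prod.mk.inj hab).1) this

lemma eval_eq_of_prod_map_freeGen_eq (w w' : List (Fin 4))
    (h : (w.map freeGen).prod = (w'.map freeGen).prod) : eval w = eval w' := by
  refine eval_eq_of_filter_eq w w' fun k => FreeGroup.mk_map_true_injective ?_
  simpa only [prod_map_freeGen_apply] using congrFun h k

end TP4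

section Relations

variable {M : Type*} [Monoid M] {a b : M} {N K : ℕ}

-- Here the relation of `R_{m,n}` is written with `m = K + 1` and `n = N + 1`.

lemma pow_eq_of_relation
    (h : (b * a ^ (N + 1)) ^ (K + 1) * (a ^ (N + 1) * b) ^ (K + 1) * a = a) :
    (b * a ^ (N + 1)) ^ (K + 1) * a ^ (N + 1) * (b * a ^ (N + 1)) ^ (K + 1) = a ^ (N + 1) := by
  rw [mul_assoc, ← mul_pow_mul, pow_succ' a N, ← mul_assoc, ← mul_assoc, ← pow_succ' a N, h,
    ← pow_succ']

lemma commute_pow_two_mul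
    (h : (b * a ^ (N + 1)) ^ (K + 1) * (a ^ (N + 1) * b) ^ (K + 1) * a = a) :
    Commute (a ^ (2 * (N + 1))) ((b * a ^ (N + 1)) ^ (K + 1)) := by
  have hc := pow_eq_of_relation h
  rw [two_mul, pow_add]
  set c := a ^ (N + 1)
  set y := (b * c) ^ (K + 1)
  calc c * c * y = (y * c * y) * c * y := by rw [hc]
    _ = y * c * (y * c * y) := by simp only [mul_assoc]
    _ = y * (c * c) := by rw [hc, mul_assoc]

lemma commute_mul_pow_mul_mul_pow (hN : 1 ≤ N)
    (h : (b * a ^ (N + 1)) ^ (K + 1) * (a ^ (N + 1) * b) ^ (K + 1) * a = a) :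
    Commute (a * (b * a ^ (N + 1)) ^ K * b * a ^ N) (a ^ (2 * (N + 1))) := by
  have hc := pow_eq_of_relation h
  have hy : (b * a ^ (N + 1)) ^ (K + 1) = (b * a ^ (N + 1)) ^ K * b * a ^ (N + 1) := by
    rw [pow_succ, mul_assoc]
  have hq : (a ^ (N + 1) * b) ^ (K + 1) = a ^ (N + 1) * ((b * a ^ (N + 1)) ^ K * b) := by
    rw [pow_succ, ← mul_assoc, ← mul_assoc, mul_pow_mul]
  have hcQ : a ^ (N + 1) * (a ^ (N + 1) * b) ^ (K + 1) * a =
      (b * a ^ (N + 1)) ^ (K + 1) * a ^ (N + 1) * a := by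
    conv_lhs =>
      rw [mul_assoc]
      arg 1
      rw [← hc]
    rw [mul_assoc, ← mul_assoc ((b * a ^ (N + 1)) ^ (K + 1)) _ a, h]
  obtain ⟨L, rfl⟩ : ∃ L, N = L + 1 := ⟨N - 1, by omega⟩
  rw [hq] at hcQ
  set S := (b * a ^ (L + 1 + 1)) ^ K * b
  have hS : a ^ (2 * (L + 1 + 1)) * S * a = S * a ^ (2 * (L + 1 + 1)) * a := by
    rw [two_mul, pow_add, mul_assoc (a ^ (L + 1 + 1)), hcQ, hy, mul_assoc S]
  have e : a * (b * a ^ (L + 1 + 1)) ^ K * b * a ^ (L + 1) = a * (S * a) * a ^ L := by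
    simp only [S, mul_assoc, pow_succ' a L]
  rw [e]
  calc a * (S * a) * a ^ L * a ^ (2 * (L + 1 + 1))
      = a * (S * (a * (a ^ L * a ^ (2 * (L + 1 + 1))))) := by simp only [mul_assoc]
    _ = a * (S * (a ^ (2 * (L + 1 + 1)) * (a * a ^ L))) := by
        simp only [← pow_succ', ← pow_add]
        rw [add_comm (2 * (L + 1 + 1)), add_right_comm]
    _ = a * (S * a ^ (2 * (L + 1 + 1)) * a) * a ^ L := by simp only [mul_assoc]
    _ = a * (a ^ (2 * (L + 1 + 1)) * S * a) * a ^ L := by rw [hS]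
    _ = (a * a ^ (2 * (L + 1 + 1))) * (S * a * a ^ L) := by simp only [mul_assoc]
    _ = a ^ (2 * (L + 1 + 1)) * (a * (S * a) * a ^ L) := by
        rw [← pow_succ', pow_succ]
        simp only [mul_assoc]

lemma commute_pow_mul_pow_two_mul_mul
    (h : (b * a ^ (N + 1)) ^ (K + 1) * (a ^ (N + 1) * b) ^ (K + 1) * a = a) :
    Commute ((b * a ^ (N + 1)) ^ (K + 1))
      (b * a ^ (N + 1) * a ^ (2 * (N + 1)) * (b * a ^ (N + 1)) ^ K) := by
  have h2 := commute_pow_two_mul h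
  set t := b * a ^ (N + 1)
  have ht (j : ℕ) : Commute (t ^ (K + 1)) (t ^ j) := Commute.pow_pow_self t _ _
  exact ((Commute.pow_self t (K + 1)).mul_right h2.symm).mul_right (ht K)

end Relations

section CyclicRoot

variable {X Z : Type*} {N : ℕ}

/-- An `(N + 1)`-st root of the map `f` acting on `N + 1` copies of its domain. -/
def cyclicRoot (f : Z → Z) (x : Z × Fin (N + 1)) : Z × Fin (N + 1) :=
  (if x.2 = Fin.last N then f x.1 else x.1, x.2 + 1)

lemma cyclicRoot_last (f : Z → Z) (z : Z) : cyclicRoot f (z, Fin.last N) = (f z, 0) := by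
  simp [cyclicRoot]

lemma cyclicRoot_iterate_zero (f : Z → Z) (z : Z) (i : Fin (N + 1)) :
    (cyclicRoot f)^[i] (z, (0 : Fin (N + 1))) = (z, i) := by
  induction i using Fin.induction with
  | zero => rfl
  | succ i ih =>
    rw [Fin.val_succ, Function.iterate_succ_apply', ← Fin.val_castSucc, ih]
    simp [cyclicRoot, (Fin.castSucc_lt_last i).ne]

lemma cyclicRoot_iterate_succ (f : Z → Z) (x : Z × Fin (N + 1)) :
    (cyclicRoot f)^[N + 1] x = (f x.1, x.2) := by
  obtain ⟨z, i⟩ := x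
  have h (z : Z) : (cyclicRoot f)^[N + 1] (z, (0 : Fin (N + 1))) = (f z, 0) := by
    have := cyclicRoot_iterate_zero f z (Fin.last N)
    rw [Fin.val_last] at this
    rw [Function.iterate_succ_apply', this, cyclicRoot_last]
  calc (cyclicRoot f)^[N + 1] (z, i)
      = (cyclicRoot f)^[N + 1] ((cyclicRoot f)^[i] (z, 0)) := by rw [cyclicRoot_iterate_zero]
    _ = (cyclicRoot f)^[i] ((cyclicRoot f)^[N + 1] (z, 0)) :=
        Function.Commute.iterate_iterate_self _ _ _ _
    _ = (f z, i) := by rw [h, cyclicRoot_iterate_zero]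

lemma Function.End.pow_apply (f : Function.End X) (k : ℕ) (x : X) : (f ^ k) x = f^[k] x := by
  induction k generalizing x with
  | zero => rfl
  | succ k ih => exact ih (f x)

/-- The map `cyclicRoot f` transported along an equivalence. -/
def cyclicRootAlong (e : X ≃ Z × Fin (N + 1)) (f : Z → Z) : Function.End X :=
  fun x => e.symm (cyclicRoot f (e x))

lemma cyclicRootAlong_pow_apply (e : X ≃ Z × Fin (N + 1)) (f : Z → Z) (k : ℕ) (x : X) :
    (cyclicRootAlong e f ^ k) x = e.symm ((cyclicRoot f)^[k] (e x)) := by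
  have : Function.Semiconj e (cyclicRootAlong e f) (cyclicRoot f) := fun x => by
    simp [cyclicRootAlong]
  rw [Function.End.pow_apply, Equiv.eq_symm_apply]
  exact this.iterate_right k x

end CyclicRoot

lemma relation_of_pow_eq {M : Type*} [Monoid M] {a t c c' y : M} {m n : ℕ} (ha : a ^ n = c)
    (ht : t ^ m = y) (hycy : y * c * y = c) (hc : c * c' = 1) (hc' : c' * c = 1) :
    t * c' * a ^ n = t ∧
      (t * c' * a ^ n) ^ m * (a ^ n * (t * c')) ^ m * a = a := by
  have h₁ : t * c' * a ^ n = t := by rw [ha, mul_assoc, hc', mul_one]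
  have h₂ : (c * (t * c')) ^ m = c * y * c' := by
    let u : Mˣ := ⟨c, c', hc, hc'⟩
    rw [← ht, ← mul_assoc]
    exact Units.conj_pow u t m
  refine ⟨h₁, ?_⟩
  rw [h₁, ha, h₂, ht, ← mul_assoc, ← mul_assoc, hycy, hc, one_mul]

namespace RmnAction

variable {A : Type*} [Group A]

/-- A square root of the left translation by `h`, on two copies of the group. -/
def swapMul (h : A) (p : A × Bool) : A × Bool :=
  if p.2 then (h * p.1, false) else (p.1, true)

/-- The inverse of `swapMul h`. -/
def swapMulInv (h : A) (p : A × Bool) : A × Bool :=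
  if p.2 then (p.1, false) else (h⁻¹ * p.1, true)

/-- Left translation by `k` on one copy of the group, by `k⁻¹` on the other. -/
def twistMul (k : A) (p : A × Bool) : A × Bool :=
  (if p.2 then k⁻¹ * p.1 else k * p.1, p.2)

lemma swapMul_swapMulInv (h : A) (p : A × Bool) : swapMul h (swapMulInv h p) = p := by
  rcases p with ⟨g, _ | _⟩ <;> simp [swapMul, swapMulInv]

lemma swapMulInv_swapMul (h : A) (p : A × Bool) : swapMulInv h (swapMul h p) = p := by
  rcases p with ⟨g, _ | _⟩ <;> simp [swapMul, swapMulInv]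

lemma twistMul_swapMul_twistMul {h k : A} (hk : Commute h k) (p : A × Bool) :
    twistMul k (swapMul h (twistMul k p)) = swapMul h p := by
  rcases p with ⟨g, _ | _⟩
  · simp [swapMul, twistMul]
  · simp only [swapMul, twistMul, if_true, Bool.false_eq_true, if_false]
    rw [← mul_assoc, ← mul_assoc, ← hk.eq, mul_assoc h, mul_inv_cancel, mul_one]

variable (A) in
/-- The set on which `R_{m,n}` acts, for `m = K + 1` and `n = N + 1`: copies of `A × Bool` placed
on two sheets of an `(N + 1) × (K + 1)` grid. -/
abbrev Grid (N K : ℕ) := (A × Bool) × Fin (N + 1) × Fin (K + 1) × Bool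

variable {N K : ℕ}

/-- The decomposition of the grid into the rows permuted by `a`. -/
def rowEquiv : Grid A N K ≃ ((A × Bool) × Fin (K + 1) × Bool) × Fin (N + 1) where
  toFun x := ((x.1, x.2.2), x.2.1)
  invFun x := (x.1.1, x.2, x.1.2)
  left_inv _ := rfl
  right_inv _ := rfl

/-- The sheet carrying the entry in row `0` of the column through a given position; the last
column changes sheets between row `0` and the other rows. -/
def columnSheet (i : Fin (N + 1)) (j : Fin (K + 1)) (s : Bool) : Bool :=
  s ^^ decide (i = Fin.last N ∧ j ≠ 0)

/-- The decomposition of the grid into the columns permuted by `b a ^ n`. -/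
def columnEquiv : Grid A N K ≃ ((A × Bool) × Fin (N + 1) × Bool) × Fin (K + 1) where
  toFun x := ((x.1, x.2.1, columnSheet x.2.1 x.2.2.1 x.2.2.2), x.2.2.1)
  invFun x := (x.1.1, x.1.2.1, x.2, columnSheet x.1.2.1 x.2 x.1.2.2)
  left_inv x := by simp [columnSheet]
  right_inv x := by simp [columnSheet]

/-- The element by which `a ^ (2 * n)` translates a row. -/
def rowLabel (g : Fin 4 → A) (j : Fin (K + 1)) (s : Bool) : A :=
  if s then 1 else if j = 0 then g 1 else g 3 * (g 2)⁻¹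

/-- The element by which `(b a ^ n) ^ m` translates a column. -/
def columnLabel (g : Fin 4 → A) (i : Fin (N + 1)) (s : Bool) : A :=
  if s then 1 else if i = Fin.last N then (g 0)⁻¹ else g 2

lemma commute_rowLabel_columnLabel {g : Fin 4 → A} (h01 : Commute (g 0) (g 1))
    (h12 : Commute (g 1) (g 2)) (h23 : Commute (g 2) (g 3)) (i : Fin (N + 1)) (j : Fin (K + 1))
    (s : Bool) : Commute (rowLabel g j s) (columnLabel g i (columnSheet i j s)) := by
  have h : Commute (g 3 * (g 2)⁻¹) (g 2) := h23.symm.mul_left (Commute.refl _).inv_left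
  have h10 : Commute (g 1) (g 0)⁻¹ := h01.symm.inv_right
  by_cases hi : i = Fin.last N <;> by_cases hj : j = 0 <;> cases s <;>
    simp [rowLabel, columnLabel, columnSheet, hi, hj, h, h10, h12]

/-- The action of `a`. -/
def actA (g : Fin 4 → A) : Function.End (Grid A N K) :=
  cyclicRootAlong rowEquiv fun z => (swapMul (rowLabel g z.2.1 z.2.2) z.1, z.2)

/-- The action of `b a ^ n`. -/
def actT (g : Fin 4 → A) : Function.End (Grid A N K) :=
  cyclicRootAlong columnEquiv fun z => (twistMul (columnLabel g z.2.1 z.2.2) z.1, z.2)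

/-- The action of `a ^ n`. -/
def actC (g : Fin 4 → A) : Function.End (Grid A N K) :=
  fun x => (swapMul (rowLabel g x.2.2.1 x.2.2.2) x.1, x.2)

/-- The inverse of `actC g`. -/
def actCInv (g : Fin 4 → A) : Function.End (Grid A N K) :=
  fun x => (swapMulInv (rowLabel g x.2.2.1 x.2.2.2) x.1, x.2)

/-- The action of `(b a ^ n) ^ m`. -/
def actY (g : Fin 4 → A) : Function.End (Grid A N K) :=
  fun x => (twistMul (columnLabel g x.2.1 (columnSheet x.2.1 x.2.2.1 x.2.2.2)) x.1, x.2)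

lemma actA_pow (g : Fin 4 → A) : actA g ^ (N + 1) = (actC g : Function.End (Grid A N K)) := by
  funext x
  rw [actA, cyclicRootAlong_pow_apply, cyclicRoot_iterate_succ]
  rfl

lemma actT_pow (g : Fin 4 → A) : actT g ^ (K + 1) = (actY g : Function.End (Grid A N K)) := by
  funext x
  rw [actT, cyclicRootAlong_pow_apply, cyclicRoot_iterate_succ]
  simp [columnEquiv, actY, columnSheet]

lemma actC_mul_actCInv (g : Fin 4 → A) : actC g * actCInv g = (1 : Function.End (Grid A N K)) := by
  funext x
  exact Prod.ext (swapMul_swapMulInv _ _) rfl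

lemma actCInv_mul_actC (g : Fin 4 → A) : actCInv g * actC g = (1 : Function.End (Grid A N K)) := by
  funext x
  exact Prod.ext (swapMulInv_swapMul _ _) rfl

lemma actY_mul_actC_mul_actY {g : Fin 4 → A} (h01 : Commute (g 0) (g 1))
    (h12 : Commute (g 1) (g 2)) (h23 : Commute (g 2) (g 3)) :
    actY g * actC g * actY g = (actC g : Function.End (Grid A N K)) := by
  funext x
  exact Prod.ext (twistMul_swapMul_twistMul (commute_rowLabel_columnLabel h01 h12 h23 _ _ _) _) rfl

/-- The copy of the group `A` in the grid on which the four elements act by translations. -/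
def base (x : A) : Grid A N K := ((x, false), 0, 0, false)

lemma actC_actC_base (g : Fin 4 → A) (x : A) :
    (actC g * actC g : Function.End (Grid A N K)) (base x) = (base (g 1 * x) : Grid A N K) := by
  change actC g (actC g (base x)) = _
  simp [actC, base, swapMul, rowLabel]

lemma actY_base (hN : 1 ≤ N) (g : Fin 4 → A) (x : A) :
    actY g (base x) = (base (g 2 * x) : Grid A N K) := by
  have : (0 : Fin (N + 1)) ≠ Fin.last N := by
    rw [Ne, Fin.ext_iff]
    simp
    omega
  simp [actY, base, twistMul, columnLabel, columnSheet, this]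

lemma actT_mul_actC_mul_actC_mul_actT_pow_base (hN : 1 ≤ N) (hK : 1 ≤ K) {g : Fin 4 → A}
    (h23 : Commute (g 2) (g 3)) (x : A) :
    (actT g * (actC g * actC g) * actT g ^ K : Function.End (Grid A N K)) (base x) =
      base (g 3 * x) := by
  have h0N : (0 : Fin (N + 1)) ≠ Fin.last N := by
    rw [Ne, Fin.ext_iff]
    simp
    omega
  have h0K : Fin.last K ≠ (0 : Fin (K + 1)) := by
    rw [Ne, Fin.ext_iff]
    simp
    omega
  have h₁ : (actT g ^ K) (base x) = (((x, false), 0, Fin.last K, false) : Grid A N K) := by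
    have := cyclicRoot_iterate_zero (fun z : (A × Bool) × Fin (N + 1) × Bool =>
      (twistMul (columnLabel g z.2.1 z.2.2) z.1, z.2)) ((x, false), 0, false) (Fin.last K)
    rw [Fin.val_last] at this
    rw [actT, cyclicRootAlong_pow_apply]
    simp [columnEquiv, columnSheet, base, h0N, this]
  have h₂ : (actC g * actC g : Function.End (Grid A N K)) ((x, false), 0, Fin.last K, false) =
      ((g 3 * (g 2)⁻¹ * x, false), 0, Fin.last K, false) := by
    change actC g (actC g _) = _
    simp [actC, swapMul, rowLabel, h0K]
  have h₃ (z : A) : actT g (((z, false), 0, Fin.last K, false) : Grid A N K) =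
      base (g 2 * z) := by
    simp [actT, cyclicRootAlong, columnEquiv, cyclicRoot_last, columnSheet, h0N, base, twistMul,
      columnLabel]
  change actT g ((actC g * actC g : Function.End (Grid A N K)) ((actT g ^ K) (base x))) = _
  rw [h₁, h₂, h₃, ← mul_assoc, ← mul_assoc, h23.eq, mul_inv_cancel_right]

lemma actA_mul_actT_pow_mul_base {g : Fin 4 → A} (h01 : Commute (g 0) (g 1)) (x : A) :
    (actA g * actT g ^ K * (actT g * actCInv g) * actA g ^ N : Function.End (Grid A N K)) (base x) =
      (base (g 0 * x) : Grid A N K) := by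
  have hA (z : A) : actA g (((z, true), Fin.last N, 0, false) : Grid A N K) =
      base (g 1 * z) := by
    simp [actA, cyclicRootAlong, rowEquiv, cyclicRoot_last, base, swapMul, rowLabel]
  have hY (z : A) : actY g (((z, true), Fin.last N, 0, false) : Grid A N K) =
      ((g 0 * z, true), Fin.last N, 0, false) := by
    simp [actY, columnSheet, columnLabel, twistMul]
  have key : actA g * actT g ^ K * (actT g * actCInv g) * actA g ^ N * actA g =
      (actA g * actY g : Function.End (Grid A N K)) := by
    rw [mul_assoc, ← pow_succ, actA_pow, mul_assoc, mul_assoc (actT g), actCInv_mul_actC, mul_one,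
      mul_assoc, ← pow_succ, actT_pow]
  have := congrFun key ((((g 1)⁻¹ * x, true), Fin.last N, 0, false) : Grid A N K)
  change (actA g * actT g ^ K * (actT g * actCInv g) * actA g ^ N : Function.End (Grid A N K))
    (actA g (((g 1)⁻¹ * x, true), Fin.last N, 0, false)) =
      actA g (actY g (((g 1)⁻¹ * x, true), Fin.last N, 0, false)) at this
  rw [hA, hY, hA, mul_inv_cancel_left] at this
  rw [this, ← mul_assoc, ← h01.eq, mul_assoc, mul_inv_cancel_left]

end RmnAction

lemma FreeMonoid.ofList_listPow {σ : Type*} (w : List σ) (i : ℕ) :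
    FreeMonoid.ofList (listPow w i) = FreeMonoid.ofList w ^ i := by
  induction i with
  | zero => rfl
  | succ i ih =>
    rw [pow_succ', ← ih, ← FreeMonoid.ofList_append]
    rfl

namespace Rmn

/-- The four words generating a copy of `T(P_4)`, evaluated at elements `a`, `b` of a monoid,
where `m = K + 1` and `n = N + 1`. -/
def gen {M : Type*} [Monoid M] (N K : ℕ) (a b : M) : Fin 4 → M :=
  ![a * (b * a ^ (N + 1)) ^ K * b * a ^ N, a ^ (2 * (N + 1)), (b * a ^ (N + 1)) ^ (K + 1),
    b * a ^ (N + 1) * a ^ (2 * (N + 1)) * (b * a ^ (N + 1)) ^ K]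

lemma map_gen {M M' : Type*} [Monoid M] [Monoid M'] (f : M →* M') (N K : ℕ) (a b : M)
    (i : Fin 4) : f (gen N K a b i) = gen N K (f a) (f b) i := by
  fin_cases i <;> simp [gen]

lemma gen_comm {M : Type*} [Monoid M] {N K : ℕ} (hN : 1 ≤ N) {a b : M}
    (h : (b * a ^ (N + 1)) ^ (K + 1) * (a ^ (N + 1) * b) ^ (K + 1) * a = a) (e : Fin 3) :
    Commute (gen N K a b e.castSucc) (gen N K a b e.succ) := by
  fin_cases e
  · exact commute_mul_pow_mul_mul_pow hN h
  · exact commute_pow_two_mul h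
  · exact commute_pow_mul_pow_two_mul_mul h

lemma eval_append (m n : ℕ) (v w : List (Fin 2)) :
    eval m n (v ++ w) = eval m n v * eval m n w := by
  rw [eval, OneRelMonoid.eval, FreeMonoid.ofList_append, map_mul]
  rfl

lemma eval_listPow (m n : ℕ) (w : List (Fin 2)) (i : ℕ) :
    eval m n (listPow w i) = eval m n w ^ i := by
  rw [eval, OneRelMonoid.eval, FreeMonoid.ofList_listPow, map_pow]
  rfl

lemma relation (m n : ℕ) :
    (eval m n bw * eval m n aw ^ n) ^ m * (eval m n aw ^ n * eval m n bw) ^ m * eval m n aw =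
      eval m n aw := by
  have : eval m n (rmnLhs m n) = eval m n aw := PresentedMonoid.mk_eq_mk_of_rel ⟨rfl, rfl⟩
  simpa only [rmnLhs, eval_append, eval_listPow] using this

/-- The homomorphism from `R_{m,n}` determined by the images of `a` and `b`. -/
lemma exists_hom {M : Type*} [Monoid M] {m n : ℕ} {a b : M}
    (h : (b * a ^ n) ^ m * (a ^ n * b) ^ m * a = a) :
    ∃ f : Rmn m n →* M, f (eval m n aw) = a ∧ f (eval m n bw) = b := by
  refine ⟨PresentedMonoid.lift ![a, b] ?_, rfl, rfl⟩
  rintro _ _ ⟨rfl, rfl⟩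
  have ha : FreeMonoid.lift ![a, b] (FreeMonoid.ofList aw) = a := rfl
  have hb : FreeMonoid.lift ![a, b] (FreeMonoid.ofList bw) = b := rfl
  simpa only [rmnLhs, FreeMonoid.ofList_append, FreeMonoid.ofList_listPow, map_mul, map_pow, ha,
    hb] using h

open RmnAction in
lemma exists_hom_gen_base {A : Type*} [Group A] {N K : ℕ} (hN : 1 ≤ N) (hK : 1 ≤ K)
    {g : Fin 4 → A} (hg : ∀ e : Fin 3, Commute (g e.castSucc) (g e.succ)) :
    ∃ f : Rmn (K + 1) (N + 1) →* Function.End (Grid A N K), ∀ (i : Fin 4) (x : A),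
      f (gen N K (eval (K + 1) (N + 1) aw) (eval (K + 1) (N + 1) bw) i) (base x) =
        base (g i * x) := by
  have h01 : Commute (g 0) (g 1) := hg 0
  have h12 : Commute (g 1) (g 2) := hg 1
  have h23 : Commute (g 2) (g 3) := hg 2
  obtain ⟨ht, hrel⟩ := relation_of_pow_eq (actA_pow (N := N) (K := K) g) (actT_pow g)
    (actY_mul_actC_mul_actY h01 h12 h23) (actC_mul_actCInv g) (actCInv_mul_actC g)
  obtain ⟨f, hfa, hfb⟩ := exists_hom hrel
  have hcc : (actA g : Function.End (Grid A N K)) ^ (2 * (N + 1)) = actC g * actC g := by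
    rw [two_mul, pow_add, actA_pow]
  refine ⟨f, fun i x => ?_⟩
  rw [map_gen, hfa, hfb]
  fin_cases i
  · simp only [gen, ht]
    simpa [← mul_assoc] using actA_mul_actT_pow_mul_base h01 x
  · simpa [gen, hcc] using actC_actC_base g x
  · simpa [gen, ht, actT_pow] using actY_base hN g x
  · simpa [gen, ht, hcc] using actT_mul_actC_mul_actC_mul_actT_pow_base hN hK h23 x

end Rmn

/-- For `m, n ≥ 2`, the submonoid of `R_{m,n}` generated by the elements represented by
`a(ba^n)^{m−1}ba^{n−1}`, `a^{2n}`, `(ba^n)^m` and `ba^n a^{2n}(ba^n)^{m−1}` is isomorphic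
to the trace monoid `T(P_4)`, with these four elements corresponding (in order) to the
generators `u₁, u₂, u₃, u₄`. -/
theorem trace_monoid_embeds_in_rmn (m n : ℕ) (hm : 2 ≤ m) (hn : 2 ≤ n) :
    ∃ φ : TP4 →* Rmn m n,
      Function.Injective φ ∧
      φ (PresentedMonoid.of tracePathRel 0) =
        Rmn.eval m n (aw ++ listPow (bw ++ listPow aw n) (m - 1) ++ bw ++
          listPow aw (n - 1)) ∧
      φ (PresentedMonoid.of tracePathRel 1) = Rmn.eval m n (listPow aw (2 * n)) ∧
      φ (PresentedMonoid.of tracePathRel 2) =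
        Rmn.eval m n (listPow (bw ++ listPow aw n) m) ∧
      φ (PresentedMonoid.of tracePathRel 3) =
        Rmn.eval m n (bw ++ listPow aw n ++ listPow aw (2 * n) ++
          listPow (bw ++ listPow aw n) (m - 1)) ∧
      MonoidHom.mrange φ = Submonoid.closure
        { Rmn.eval m n (aw ++ listPow (bw ++ listPow aw n) (m - 1) ++ bw ++
            listPow aw (n - 1)),
          Rmn.eval m n (listPow aw (2 * n)),
          Rmn.eval m n (listPow (bw ++ listPow aw n) m),
          Rmn.eval m n (bw ++ listPow aw n ++ listPow aw (2 * n) ++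
            listPow (bw ++ listPow aw n) (m - 1)) } := by
  obtain ⟨K, rfl⟩ : ∃ K, m = K + 1 := ⟨m - 1, by omega⟩
  obtain ⟨N, rfl⟩ : ∃ N, n = N + 1 := ⟨n - 1, by omega⟩
  have hN : 1 ≤ N := by omega
  have hK : 1 ≤ K := by omega
  set u := Rmn.gen N K (Rmn.eval (K + 1) (N + 1) aw) (Rmn.eval (K + 1) (N + 1) bw) with hu
  have hlift : ∀ p q, tracePathRel p q → FreeMonoid.lift u p = FreeMonoid.lift u q := by
    rintro _ _ ⟨e, rfl, rfl⟩
    simp only [map_mul, FreeMonoid.lift_eval_of]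
    exact Rmn.gen_comm hN (Rmn.relation (K + 1) (N + 1)) e
  have hu0 : u 0 = Rmn.eval (K + 1) (N + 1) (aw ++ listPow (bw ++ listPow aw (N + 1)) (K + 1 - 1) ++
      bw ++ listPow aw (N + 1 - 1)) := by
    simp [hu, Rmn.gen, Rmn.eval_append, Rmn.eval_listPow, mul_assoc]
  have hu1 : u 1 = Rmn.eval (K + 1) (N + 1) (listPow aw (2 * (N + 1))) := by
    simp [hu, Rmn.gen, Rmn.eval_listPow]
  have hu2 : u 2 = Rmn.eval (K + 1) (N + 1) (listPow (bw ++ listPow aw (N + 1)) (K + 1)) := by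
    simp [hu, Rmn.gen, Rmn.eval_append, Rmn.eval_listPow]
  have hu3 : u 3 = Rmn.eval (K + 1) (N + 1) (bw ++ listPow aw (N + 1) ++ listPow aw (2 * (N + 1)) ++
      listPow (bw ++ listPow aw (N + 1)) (K + 1 - 1)) := by
    simp [hu, Rmn.gen, Rmn.eval_append, Rmn.eval_listPow, mul_assoc]
  refine ⟨PresentedMonoid.lift u hlift, ?_, hu0, hu1, hu2, hu3, ?_⟩
  · obtain ⟨f, hf⟩ := Rmn.exists_hom_gen_base hN hK TP4.freeGen_comm
    have hword (w : List (Fin 4)) : f (PresentedMonoid.lift u hlift (TP4.eval w))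
        (RmnAction.base 1) = RmnAction.base (w.map TP4.freeGen).prod := by
      induction w with
      | nil =>
        have : TP4.eval [] = 1 := map_one _
        rw [this, map_one, map_one]
        rfl
      | cons i w ih =>
        rw [TP4.eval_cons, map_mul, map_mul, PresentedMonoid.lift_of, List.map_cons,
          List.prod_cons, ← hf, ← ih]
        rfl
    intro p q hpq
    obtain ⟨v, rfl⟩ := PresentedMonoid.surjective_mk p
    obtain ⟨w, rfl⟩ := PresentedMonoid.surjective_mk q
    refine TP4.eval_eq_of_prod_map_freeGen_eq v.toList w.toList ?_
    have h := (hword v.toList).symm.trans ((congrFun (congrArg f hpq) _).trans (hword w.toList))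
    exact congrArg (fun x => x.1.1) h
  · rw [MonoidHom.mrange_eq_map, ← PresentedMonoid.closure_range_of, MonoidHom.map_mclosure,
      ← Set.range_comp]
    congr 1
    rw [← hu0, ← hu1, ← hu2, ← hu3]
    ext x
    simp [Fin.exists_fin_succ, eq_comm]
end

section
/- Let G be a group, let A be a subset of G, fix a ∈ A, and let M be the submonoid of G generated by A. Suppose R is a set of pairs of words over A such that the evaluation map induces a monoid isomorphism from the presented monoid Mon⟨A | R⟩ onto M. Let H be the HNN extension of G with stable letter t associated to the identity isomorphism of the cyclic subgroup ⟨a⟩ = Subgroup.zpowers a of G (so in H one has t a t^{-1} = a). Then the map sending each element of A to its image in H and sending a new letter to t induces a monoid isomorphism from the presented monoid Mon⟨A, t | R, a·t = t·a⟩ onto the submonoid of H generated by the image of M together with t. -/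
namespace HNNExtension

variable {G Q P : Type*} [Group G] [Monoid Q] [Monoid P]

/-- The element `ι q * s * ι x₁ * s * ι x₂ * ⋯ * s * ι xₙ`, for `l = [x₁, …, xₙ]`. -/
def stableWord (ι : Q →* P) (s : P) (q : Q) (l : List Q) : P :=
  ι q * (l.map fun x => s * ι x).prod

theorem stableWord_cons (ι : Q →* P) (s : P) (q x : Q) (l : List Q) :
    stableWord ι s q (x :: l) = ι q * s * stableWord ι s x l := by
  simp [stableWord, mul_assoc]

theorem mul_stableWord (ι : Q →* P) (s : P) (p q : Q) (l : List Q) :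
    ι p * stableWord ι s q l = stableWord ι s (p * q) l := by
  simp [stableWord, mul_assoc]

theorem stableWord_mul_pow_cons (ι : Q →* P) (s : P) {α : Q} (hα : Commute (ι α) s) (n : ℕ)
    (q x : Q) (l : List Q) :
    stableWord ι s (q * α ^ n) (x :: l) = ι q * s * stableWord ι s (α ^ n * x) l := by
  rw [stableWord_cons, ← mul_stableWord, map_mul, map_pow, mul_assoc (ι q),
    (hα.pow_left n).eq]
  simp only [mul_assoc]

theorem exists_eq_stableWord (ι : Q →* P) (s : P)
    (hgen : Submonoid.closure (Set.range ι ∪ {s}) = ⊤) (p : P) :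
    ∃ q l, p = stableWord ι s q l := by
  have hp : p ∈ Submonoid.closure (Set.range ι ∪ {s}) := hgen ▸ Submonoid.mem_top p
  induction hp using Submonoid.closure_induction_left with
  | one => exact ⟨1, [], by simp [stableWord]⟩
  | mul_left x hx y _ ih =>
    obtain ⟨q, l, rfl⟩ := ih
    rcases hx with ⟨r, rfl⟩ | rfl
    · exact ⟨r * q, l, mul_stableWord ι s r q l⟩
    · exact ⟨1, q :: l, by simp [stableWord_cons]⟩

/-- The word `g * t * g₁ * t * ⋯ * t * gₙ`, which is reduced since all exponents are positive. -/
def positiveWord (A B : Subgroup G) (g : G) (l : List G) : NormalWord.ReducedWord G A B where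
  head := g
  toList := l.map fun x => (1, x)
  chain := by
    rw [List.isChain_map]
    exact (List.pairwise_of_forall fun _ _ _ => rfl).isChain

theorem positiveWord_prod {A B : Subgroup G} (φ : A ≃* B) (g : G) (l : List G) :
    (positiveWord A B g l).prod φ = stableWord of t g l := by
  simp [positiveWord, NormalWord.ReducedWord.prod, stableWord, Function.comp_def]

theorem stableWord_eq_of_map_eq {a : G}
    {θ : P →* HNNExtension G (Subgroup.zpowers a) (Subgroup.zpowers a) (MulEquiv.refl _)}
    {ψ : Q →* G} (hψ : Function.Injective ψ) {ι : Q →* P} {s : P}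
    (hι : ∀ q, θ (ι q) = of (ψ q)) (hs : θ s = t) {α : Q} (hα : ψ α = a)
    (hcomm : Commute (ι α) s) (l l' : List Q) (q q' : Q)
    (h : θ (stableWord ι s q l) = θ (stableWord ι s q' l')) :
    stableWord ι s q l = stableWord ι s q' l' := by
  have hθ (q : Q) (l : List Q) : θ (stableWord ι s q l) =
      (positiveWord (Subgroup.zpowers a) (Subgroup.zpowers a) (ψ q) (l.map ψ)).prod
        (MulEquiv.refl _) := by
    rw [positiveWord_prod]
    simp [stableWord, map_list_prod, Function.comp_def, hι, hs]
  induction l generalizing l' q q' with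
  | nil =>
    have hw := (ReducedWord.map_fst_eq_and_of_prod_eq _ ((hθ q []).symm.trans
      (h.trans (hθ q' l')))).1
    obtain rfl : l' = [] := by simpa [positiveWord] using hw
    have : q = q' := hψ (of_injective (φ := MulEquiv.refl (Subgroup.zpowers a)) (by
      simpa [stableWord, hι] using h))
    rw [this]
  | cons x l ih =>
    obtain ⟨hlen, hmem⟩ := ReducedWord.map_fst_eq_and_of_prod_eq _ ((hθ q (x :: l)).symm.trans
      (h.trans (hθ q' l')))
    cases l' with
    | nil => simp [positiveWord] at hlen
    | cons x' l' =>
      have hz : (ψ q)⁻¹ * ψ q' ∈ Subgroup.zpowers a := by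
        simpa [positiveWord] using hmem 1 (by simp [positiveWord])
      obtain ⟨i, hi⟩ := Subgroup.mem_zpowers_iff.1 hz
      obtain ⟨n, rfl | rfl⟩ := i.eq_nat_or_neg
      · obtain rfl : q' = q * α ^ n := hψ (by simp [hα, ← zpow_natCast, hi])
        rw [stableWord_mul_pow_cons ι s hcomm, stableWord_cons] at h ⊢
        rw [map_mul θ (ι _ * s), map_mul θ (ι _ * s), mul_right_inj] at h
        rw [ih _ _ _ h]
      · obtain rfl : q = q' * α ^ n := hψ (by
          rw [zpow_neg, inv_eq_iff_eq_inv, zpow_natCast] at hi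
          simp [hα, hi])
        rw [stableWord_mul_pow_cons ι s hcomm, stableWord_cons] at h ⊢
        rw [map_mul θ (ι _ * s), map_mul θ (ι _ * s), mul_right_inj] at h
        rw [ih _ _ _ h]

end HNNExtension

/-- Let `G` be a group, `A ⊆ G`, `a ∈ A`, and let `M` be the submonoid of `G` generated
by `A`.  Suppose `R` is a set of pairs of words over `A` such that evaluation induces a
monoid isomorphism from the presented monoid `Mon⟨A | R⟩` onto `M`.  Let `H` be the HNN
extension of `G` with stable letter `t` along the identity isomorphism of the cyclic
subgroup generated by `a` (so `t a t⁻¹ = a` in `H`).  Then sending each element of `A`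
to its image in `H` and the extra letter to `t` induces a monoid isomorphism from
`Mon⟨A, t | R, a·t = t·a⟩` onto the submonoid of `H` generated by the image of `M`
together with `t`. -/
theorem hnn_extension_submonoid_presentation
    (G : Type) [Group G] (A : Set G) (a : G) (ha : a ∈ A)
    (R : Set (FreeMonoid ↥A × FreeMonoid ↥A))
    (hpres : ∃ ψ : PresentedMonoid (fun x y : FreeMonoid ↥A => (x, y) ∈ R) →* G,
      (∀ x : ↥A, ψ (PresentedMonoid.of _ x) = ↑x) ∧ Function.Injective ψ ∧
      MonoidHom.mrange ψ = Submonoid.closure A) :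
    ∃ θ : PresentedMonoid (fun x y : FreeMonoid (Option ↥A) =>
        (∃ p ∈ R, x = FreeMonoid.map some p.1 ∧ y = FreeMonoid.map some p.2) ∨
        (x = FreeMonoid.of (some ⟨a, ha⟩) * FreeMonoid.of none ∧
          y = FreeMonoid.of none * FreeMonoid.of (some ⟨a, ha⟩))) →*
      HNNExtension G (Subgroup.zpowers a) (Subgroup.zpowers a)
        (MulEquiv.refl ↥(Subgroup.zpowers a)),
      (∀ x : ↥A, θ (PresentedMonoid.of _ (some x)) = HNNExtension.of ↑x) ∧
      θ (PresentedMonoid.of _ none) = HNNExtension.t ∧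
      Function.Injective θ ∧
      MonoidHom.mrange θ = Submonoid.closure
        (HNNExtension.of '' ((Submonoid.closure A : Submonoid G) : Set G) ∪
          {HNNExtension.t}) := by
  obtain ⟨ψ, hψ, hinj, -⟩ := hpres
  let f : Option A → HNNExtension G (Subgroup.zpowers a) (Subgroup.zpowers a)
      (MulEquiv.refl (Subgroup.zpowers a)) :=
    fun o => o.elim HNNExtension.t fun x => HNNExtension.of (x : G)
  have hlift : (FreeMonoid.lift f).comp (FreeMonoid.map some) =
      (HNNExtension.of.comp ψ).comp (PresentedMonoid.mk _) := by
    ext x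
    exact congrArg HNNExtension.of (hψ x).symm
  let rels := fun x y : FreeMonoid (Option A) =>
        (∃ p ∈ R, x = FreeMonoid.map some p.1 ∧ y = FreeMonoid.map some p.2) ∨
        (x = FreeMonoid.of (some ⟨a, ha⟩) * FreeMonoid.of none ∧
          y = FreeMonoid.of none * FreeMonoid.of (some ⟨a, ha⟩))
  have hrel : ∀ x y, rels x y → FreeMonoid.lift f x = FreeMonoid.lift f y := by
    rintro x y (⟨p, hp, rfl, rfl⟩ | ⟨rfl, rfl⟩)
    · have h₁ := DFunLike.congr_fun hlift p.1
      have h₂ := DFunLike.congr_fun hlift p.2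
      simp only [MonoidHom.comp_apply] at h₁ h₂
      rw [h₁, h₂, PresentedMonoid.mk_eq_mk_of_rel hp]
    · simpa [f] using (HNNExtension.t_mul_of (φ := MulEquiv.refl (Subgroup.zpowers a))
        ⟨a, Subgroup.mem_zpowers a⟩).symm
  refine ⟨PresentedMonoid.lift f hrel, fun x => rfl, rfl, ?_, ?_⟩
  · have hmk : (FreeMonoid.lift fun x : A => PresentedMonoid.of rels (some x)) =
        (PresentedMonoid.mk rels).comp (FreeMonoid.map some) := by
      ext x
      rfl
    let ι : PresentedMonoid (fun x y : FreeMonoid A => (x, y) ∈ R) →* PresentedMonoid rels :=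
      PresentedMonoid.lift (fun x => PresentedMonoid.of rels (some x)) fun x y hxy => by
        rw [hmk]
        exact PresentedMonoid.mk_eq_mk_of_rel (Or.inl ⟨(x, y), hxy, rfl, rfl⟩)
    have hgen : Submonoid.closure (Set.range ι ∪ {PresentedMonoid.of rels none}) = ⊤ := by
      rw [eq_top_iff, ← PresentedMonoid.closure_range_of rels]
      refine Submonoid.closure_mono ?_
      rintro _ ⟨_ | x, rfl⟩
      · exact Or.inr rfl
      · exact Or.inl ⟨PresentedMonoid.of _ x, rfl⟩
    have hcomm : Commute (ι (PresentedMonoid.of _ ⟨a, ha⟩)) (PresentedMonoid.of rels none) :=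
      PresentedMonoid.mk_eq_mk_of_rel (rels := rels) (Or.inr ⟨rfl, rfl⟩)
    intro p p' h
    obtain ⟨q, l, rfl⟩ := HNNExtension.exists_eq_stableWord ι _ hgen p
    obtain ⟨q', l', rfl⟩ := HNNExtension.exists_eq_stableWord ι _ hgen p'
    refine HNNExtension.stableWord_eq_of_map_eq (a := a) (θ := PresentedMonoid.lift f hrel) hinj
      (fun q => ?_) rfl (hψ ⟨a, ha⟩) hcomm l l' q q' h
    refine DFunLike.congr_fun (f := MonoidHom.comp (PresentedMonoid.lift f hrel) ι)
      (g := HNNExtension.of.comp ψ) ?_ q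
    ext x
    exact congrArg HNNExtension.of (hψ x).symm
  · rw [MonoidHom.mrange_eq_map, ← PresentedMonoid.closure_range_of, MonoidHom.map_mclosure]
    apply le_antisymm
    · refine Submonoid.closure_mono ?_
      rintro _ ⟨_, ⟨_ | x, rfl⟩, rfl⟩
      · exact Or.inr rfl
      · exact Or.inl ⟨x, Submonoid.subset_closure x.2, rfl⟩
    · rw [Submonoid.closure_le, Set.union_subset_iff, Set.image_subset_iff,
        Set.singleton_subset_iff]
      refine ⟨?_, Submonoid.subset_closure ⟨_, ⟨none, rfl⟩, rfl⟩⟩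
      rw [← Submonoid.coe_comap, SetLike.coe_subset_coe, Submonoid.closure_le]
      exact fun x hx => Submonoid.subset_closure ⟨_, ⟨some ⟨x, hx⟩, rfl⟩, rfl⟩
end
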